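/- arXiv:1509.02254 — 5 statements merged into one kernel-verified Lean document; each statement's English description precedes it below -/
import Mathlib

section
/- Let P_1, …, P_k be lattice polytopes in ℝ^d such that P_1 + ⋯ + P_k is d-dimensional. Then for every 0 ≤ i ≤ d, the coefficient me_i of n^i in the mixed Ehrhart polynomial ME_{P_1,…,P_k}(n) equals the sum of the coefficients e_α of the multivariate Ehrhart polynomial E_𝐏 over all α ∈ ℤ_{≥1}^k with α_1 + ⋯ + α_k = i (i.e., over all exponent vectors with every entry at least 1 and total degree i). -/
open Pointwise MeasureTheory Filter
open scoped Classical

/-- A lattice polytope in `ℝ^d`: the convex hull of finitely many integer points. -/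
def IsLatticePolytope {d : ℕ} (P : Set (Fin d → ℝ)) : Prop :=
  ∃ V : Finset (Fin d → ℤ), V.Nonempty ∧
    P = convexHull ℝ ((fun z : Fin d → ℤ => fun i => (z i : ℝ)) '' ↑V)

/-- The number of lattice points of a subset of `ℝ^d`. -/
noncomputable def latticePointCount {d : ℕ} (P : Set (Fin d → ℝ)) : ℕ :=
  Set.ncard {z : Fin d → ℤ | (fun i => (z i : ℝ)) ∈ P}

/-- The discrete mixed volume `DMV(P_1, …, P_k)`; here `∑ j ∈ J, P j` is a Minkowski
sum of sets, with the empty sum being `{0}`. -/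
noncomputable def DMV {d k : ℕ} (P : Fin k → Set (Fin d → ℝ)) : ℤ :=
  ∑ J : Finset (Fin k), (-1) ^ (k - J.card) * (latticePointCount (∑ j ∈ J, P j) : ℤ)

/-- The dimension of a polytope: the dimension of its affine hull. -/
noncomputable def polytopeDim {d : ℕ} (P : Set (Fin d → ℝ)) : ℕ :=
  Module.finrank ℝ (affineSpan ℝ P).direction

/-- The indicator vector of `J` scaled by `n` picks out the dilated Minkowski sum over `J`. -/
theorem sum_indicator_smul_eq_sum {d k : ℕ} (P : Fin k → Set (Fin d → ℝ))
    (hP : ∀ i, (P i).Nonempty) (n : ℕ) (J : Finset (Fin k)) :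
    ∑ i, (((if i ∈ J then n else 0 : ℕ) : ℝ)) • P i = ∑ j ∈ J, (n : ℝ) • P j := by
  rw [← Finset.sum_subset (Finset.subset_univ J)
    (f := fun i => (((if i ∈ J then n else 0 : ℕ) : ℝ)) • P i)]
  · exact Finset.sum_congr rfl fun j hj => by simp only [if_pos hj]
  · intro j _ hj
    simp only [if_neg hj, Nat.cast_zero]
    exact Set.zero_smul_set (hP j)

/-- The alternating sum over all index sets of a monomial evaluated at scaled indicator vectors
keeps exactly the monomials in which every variable occurs. -/
theorem sum_neg_one_pow_mul_prod_indicator_pow {R : Type*} [CommRing R] {k : ℕ}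
    (x : R) (α : Fin k → ℕ) :
    ∑ J : Finset (Fin k), (-1) ^ (k - J.card) * ∏ j, (if j ∈ J then x else 0) ^ α j
      = if ∀ j, 1 ≤ α j then x ^ ∑ j, α j else 0 := by
  have key : ∑ J : Finset (Fin k), (-1) ^ (k - J.card) * ∏ j, (if j ∈ J then x else 0) ^ α j
      = ∏ j, (x ^ α j + -(0 ^ α j)) := by
    rw [Finset.prod_add, Finset.powerset_univ]
    refine Finset.sum_congr rfl fun J _ => ?_
    rw [Finset.prod_neg, Finset.card_univ_sdiff, Fintype.card_fin,
      ← Finset.prod_sdiff (Finset.subset_univ J),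
      Finset.prod_congr rfl (g := fun j => (0 : R) ^ α j)
        (fun j hj => by rw [if_neg (Finset.mem_sdiff.1 hj).2]),
      Finset.prod_congr (s₁ := J) rfl (g := fun j => x ^ α j) (fun j hj => by rw [if_pos hj])]
    ring
  rw [key]
  split_ifs with h
  · rw [← Finset.prod_pow_eq_pow_sum]
    refine Finset.prod_congr rfl fun j _ => ?_
    rw [zero_pow (Nat.one_le_iff_ne_zero.1 (h j)), neg_zero, add_zero]
  · push Not at h
    obtain ⟨j, hj⟩ := h
    refine Finset.prod_eq_zero (Finset.mem_univ j) ?_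
    simp [Nat.lt_one_iff.1 hj]

/-- **Mixed Ehrhart coefficients via the multivariate Ehrhart polynomial.**
If `P_1 + ⋯ + P_k` is `d`-dimensional, `M` is the mixed Ehrhart polynomial of
`(P_1, …, P_k)` and `E` is the multivariate Ehrhart polynomial, then for `0 ≤ i ≤ d`
the coefficient of `n^i` in `M` equals the sum of the coefficients `e_α` of `E`
over all `α ∈ ℤ_{≥1}^k` with `α_1 + ⋯ + α_k = i`. -/
theorem mixed_ehrhart_coeff_eq_sum_multivariate_coeffs
    {d k : ℕ} (P : Fin k → Set (Fin d → ℝ))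
    (hP : ∀ i, IsLatticePolytope (P i))
    (hdim : polytopeDim (∑ i, P i) = d)
    (M : Polynomial ℝ) (hMdeg : M.natDegree ≤ d)
    (hM : ∀ n : ℕ, M.eval (n : ℝ) = (DMV (fun i => (n : ℝ) • P i) : ℝ))
    (E : MvPolynomial (Fin k) ℝ)
    (hE : ∀ n : Fin k → ℕ,
      MvPolynomial.eval (fun i => (n i : ℝ)) E
        = (latticePointCount (∑ i, (n i : ℝ) • P i) : ℝ))
    (i : ℕ) (hi : i ≤ d) :
    M.coeff i
      = ∑ α ∈ E.support.filter (fun α => (∀ j, 1 ≤ α j) ∧ ∑ j, α j = i),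
          E.coeff α := by
  have hne : ∀ i, (P i).Nonempty := fun i => by
    obtain ⟨V, hV, h⟩ := hP i
    rw [h]
    exact ((Finset.coe_nonempty.2 hV).image _).convexHull
  have hpoly : M = ∑ α ∈ E.support.filter (fun α => ∀ j, 1 ≤ α j),
      Polynomial.C (E.coeff α) * Polynomial.X ^ ∑ j, α j := by
    refine Polynomial.eq_of_infinite_eval_eq _ _
      ((Set.infinite_range_of_injective (Nat.cast_injective (R := ℝ))).mono ?_)
    rintro _ ⟨n, rfl⟩
    have hJ : ∀ J : Finset (Fin k), (latticePointCount (∑ j ∈ J, (n : ℝ) • P j) : ℝ)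
        = ∑ α ∈ E.support, E.coeff α * ∏ j, (if j ∈ J then (n : ℝ) else 0) ^ α j := by
      intro J
      rw [← sum_indicator_smul_eq_sum P hne, ← hE, MvPolynomial.eval_eq']
      simp only [Nat.cast_ite, Nat.cast_zero]
    simp only [Set.mem_ofPred_eq, hM, DMV, Int.cast_sum, Int.cast_mul, Int.cast_pow, Int.cast_neg,
      Int.cast_one, Int.cast_natCast, hJ, Finset.mul_sum]
    rw [Finset.sum_comm, Polynomial.eval_finsetSum, Finset.sum_filter]
    refine Finset.sum_congr rfl fun α _ => ?_
    simp only [mul_left_comm _ (E.coeff α), ← Finset.mul_sum,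
      sum_neg_one_pow_mul_prod_indicator_pow]
    split_ifs <;> simp
  rw [hpoly, Polynomial.finsetSum_coeff, ← Finset.filter_filter, Finset.sum_filter (fun α : Fin k →₀ ℕ => ∑ j, α j = i)]
  simp only [Polynomial.coeff_C_mul_X_pow, eq_comm]
end

section
/- Let P_1, …, P_k be lattice polytopes in ℝ^d. Then the coefficient me_i of n^i in the mixed Ehrhart polynomial ME_{P_1,…,P_k}(n) vanishes for all 0 ≤ i < k; equivalently, n^k divides ME_{P_1,…,P_k}(n). -/
open Pointwise MeasureTheory Filter
open scoped Classical

section LexTriangulation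

/-- Coefficient vectors of the half-open simplicial cone spanned by `B`, with the facets
opposite to the nonpositive coordinates of `w` removed. -/
structure IsHalfOpen {ι : Type*} (B : Finset ι) (w a : ι → ℝ) : Prop where
  eq_zero : ∀ j ∉ B, a j = 0
  nonneg : ∀ j, 0 ≤ a j
  pos : ∀ j ∈ B, w j ≤ 0 → 0 < a j

theorem IsHalfOpen.eventually_pos {ι : Type*} {B : Finset ι} {w a : ι → ℝ} (h : IsHalfOpen B w a) :
    ∀ᶠ t in nhdsWithin (0 : ℝ) (Set.Ioi 0), ∀ j ∈ B, 0 < a j + t * w j := by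
  rw [Finset.eventually_all]
  intro j hj
  rcases le_or_gt (w j) 0 with hw | hw
  · have : Tendsto (fun t : ℝ => a j + t * w j) (nhdsWithin 0 (Set.Ioi 0)) (nhds (a j)) := by
      have hcont : Continuous fun t : ℝ => a j + t * w j := by fun_prop
      simpa using (hcont.tendsto 0).mono_left nhdsWithin_le_nhds
    exact this.eventually (lt_mem_nhds (h.pos j hj hw))
  · filter_upwards [self_mem_nhdsWithin] with t ht
    exact add_pos_of_nonneg_of_pos (h.nonneg j) (mul_pos ht hw)

variable {ι E : Type*} [LinearOrder ι] [AddCommGroup E] [Module ℝ E]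

/-- A vector is lexicographically negative if its first nonzero coordinate is negative. -/
def LexNeg (c : ι → ℝ) : Prop := ∃ i, c i < 0 ∧ ∀ j < i, c j = 0

theorem LexNeg.smul {c : ι → ℝ} (hc : LexNeg c) {t : ℝ} (ht : 0 < t) : LexNeg (t • c) := by
  obtain ⟨i, hi, h⟩ := hc
  exact ⟨i, by simpa using mul_neg_of_pos_of_neg ht hi, fun j hj => by simp [h j hj]⟩

variable [Fintype ι]

theorem eq_zero_of_not_lexNeg {c : ι → ℝ} (h₁ : ¬ LexNeg c) (h₂ : ¬ LexNeg (-c)) : c = 0 := by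
  by_contra hc
  have hne : (Finset.univ.filter fun i => c i ≠ 0).Nonempty := by
    obtain ⟨i, hi⟩ := Function.ne_iff.1 hc
    exact ⟨i, by simpa using hi⟩
  obtain ⟨i, hi, hmin⟩ := Finset.exists_minimal hne
  have hi' : c i ≠ 0 := by simpa using hi
  have hlt : ∀ j < i, c j = 0 := by
    intro j hj
    by_contra hcj
    exact absurd (hmin (by simpa using hcj) hj.le) (not_le.2 hj)
  rcases lt_or_gt_of_ne hi' with h | h
  · exact h₁ ⟨i, h, hlt⟩
  · exact h₂ ⟨i, by simpa using h, fun j hj => by simp [hlt j hj]⟩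

/-- A nonempty compact set has a lexicographically minimal element. -/
theorem IsCompact.exists_forall_not_lexNeg {K : Set (ι → ℝ)} (hK : IsCompact K)
    (hne : K.Nonempty) : ∃ a ∈ K, ∀ b ∈ K, ¬ LexNeg (b - a) := by
  have key : ∀ s : Finset ι, ∃ L ⊆ K, IsCompact L ∧ L.Nonempty ∧
      (∀ a ∈ L, ∀ b ∈ K, (∀ j ∈ s, b j = a j) → b ∈ L) ∧
      ∀ a ∈ L, ∀ b ∈ K, ∀ i ∈ s, (∀ j ∈ s, j < i → b j = a j) → a i ≤ b i := by
    intro s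
    induction s using Finset.induction_on_max with
    | empty => exact ⟨K, subset_rfl, hK, hne, fun a _ b hb _ => hb, by simp⟩
    | insert m s hm ih =>
      obtain ⟨L, hLK, hL, hLne, hclosed, hmin⟩ := ih
      obtain ⟨a₀, ha₀, ha₀min⟩ :=
        hL.exists_isMinOn hLne (f := fun a => a m) (continuous_apply m).continuousOn
      have hms : m ∉ s := fun h => lt_irrefl _ (hm m h)
      refine ⟨L ∩ {a | a m = a₀ m}, fun a ha => hLK ha.1,
        hL.inter_right (isClosed_eq (continuous_apply m) continuous_const),
        ⟨a₀, ha₀, rfl⟩, ?_, ?_⟩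
      · rintro a ⟨haL, ham⟩ b hb hab
        exact ⟨hclosed a haL b hb fun j hj => hab j (Finset.mem_insert_of_mem hj),
          (hab m (Finset.mem_insert_self _ _)).trans ham⟩
      · rintro a ⟨haL, ham⟩ b hb i hi hab
        rcases Finset.mem_insert.1 hi with rfl | hi
        · have hbL := hclosed a haL b hb fun j hj => hab j (Finset.mem_insert_of_mem hj) (hm j hj)
          have := ha₀min hbL
          simp only [Set.mem_ofPred_eq] at this ham
          rw [ham]; exact this
        · exact hmin a haL b hb i hi fun j hj => hab j (Finset.mem_insert_of_mem hj)
  obtain ⟨L, hLK, -, ⟨a, ha⟩, -, hmin⟩ := key Finset.univ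
  refine ⟨a, hLK ha, fun b hb => ?_⟩
  rintro ⟨i, hi, h⟩
  have := hmin a ha b hb i (Finset.mem_univ _) fun j _ hj => sub_eq_zero.1 (h j hj)
  simp only [Pi.sub_apply] at hi
  linarith

/-- The supports of lexicographically minimal nonnegative representations with respect to `U`;
these are the simplices of a triangulation of the image of the positive orthant. -/
def IsLexSimplex (U : (ι → ℝ) →ₗ[ℝ] E) (B : Finset ι) : Prop :=
  ∀ c, U c = 0 → (∀ j ∉ B, 0 ≤ c j) → ¬ LexNeg c

variable {U : (ι → ℝ) →ₗ[ℝ] E}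

theorem IsLexSimplex.eq_zero {B : Finset ι} (hB : IsLexSimplex U B) {c : ι → ℝ} (hU : U c = 0)
    (hc : ∀ j ∉ B, c j = 0) : c = 0 :=
  eq_zero_of_not_lexNeg (hB c hU fun j hj => (hc j hj).ge)
    (hB (-c) (by simp [hU]) fun j hj => by simp [hc j hj])

theorem IsLexSimplex.eq {B : Finset ι} (hB : IsLexSimplex U B) {a b : ι → ℝ} (hU : U a = U b)
    (ha : ∀ j ∉ B, a j = 0) (hb : ∀ j ∉ B, b j = 0) : a = b :=
  sub_eq_zero.1 <| hB.eq_zero (by simp [hU]) fun j hj => by simp [ha j hj, hb j hj]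

theorem IsLexSimplex.eq_of_nonneg {B B' : Finset ι} (hB : IsLexSimplex U B)
    (hB' : IsLexSimplex U B') {a b : ι → ℝ} (hU : U a = U b) (ha0 : 0 ≤ a) (hb0 : 0 ≤ b)
    (ha : ∀ j ∉ B, a j = 0) (hb : ∀ j ∉ B', b j = 0) : a = b := by
  refine sub_eq_zero.1 <| eq_zero_of_not_lexNeg
    (hB' _ (by simp [hU]) fun j hj => ?_) (hB _ (by simp [hU]) fun j hj => ?_)
  · simpa [hb j hj] using ha0 j
  · simpa [ha j hj] using hb0 j

theorem exists_isLexSimplex_support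
    (hU : ∀ x, IsCompact {a : ι → ℝ | 0 ≤ a ∧ U a = x}) {a : ι → ℝ} (ha : 0 ≤ a) :
    ∃ B a', 0 ≤ a' ∧ U a' = U a ∧ IsLexSimplex U B ∧ ∀ j, a' j ≠ 0 ↔ j ∈ B := by
  obtain ⟨b, ⟨hb0, hbU⟩, hmin⟩ := (hU (U a)).exists_forall_not_lexNeg ⟨a, ha, rfl⟩
  refine ⟨Finset.univ.filter fun j => b j ≠ 0, b, hb0, hbU, ?_, by simp⟩
  intro c hc hcB hneg
  have hev : ∀ᶠ t in nhdsWithin (0 : ℝ) (Set.Ioi 0), ∀ j, 0 ≤ b j + t * c j := by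
    rw [Filter.eventually_all]
    intro j
    by_cases hj : b j = 0
    · filter_upwards [self_mem_nhdsWithin] with t ht
      have := hcB j (by simpa using hj)
      rw [hj, zero_add]
      exact mul_nonneg (le_of_lt ht) this
    · have hpos : 0 < b j := lt_of_le_of_ne (hb0 j) (Ne.symm hj)
      have : Tendsto (fun t : ℝ => b j + t * c j) (nhdsWithin 0 (Set.Ioi 0)) (nhds (b j)) := by
        have hcont : Continuous fun t : ℝ => b j + t * c j := by fun_prop
        simpa using (hcont.tendsto 0).mono_left nhdsWithin_le_nhds
      exact (this.eventually (lt_mem_nhds hpos)).mono fun t ht => le_of_lt ht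
  obtain ⟨t, ht, ht0⟩ := (hev.and self_mem_nhdsWithin).exists
  refine hmin (b + t • c) ⟨fun j => by simpa using ht j, by simp [hc, hbU]⟩ ?_
  simpa using hneg.smul ht0

/-- A maximal cell of the triangulation, in the direction `U 1`: the span of the simplex `B`
contains `U 1`, with coordinates `w`. -/
structure IsLexCell (U : (ι → ℝ) →ₗ[ℝ] E) (B : Finset ι) (w : ι → ℝ) : Prop where
  isLexSimplex : IsLexSimplex U B
  eq_zero : ∀ j ∉ B, w j = 0
  map_eq : U w = U 1

theorem IsLexCell.unique {B B' : Finset ι} {w w' a a' : ι → ℝ} (hB : IsLexCell U B w)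
    (hB' : IsLexCell U B' w') (ha : IsHalfOpen B w a) (ha' : IsHalfOpen B' w' a')
    (hU : U a = U a') : B = B' ∧ w = w' ∧ a = a' := by
  obtain ⟨t, ht, ht'⟩ := (ha.eventually_pos.and ha'.eventually_pos).exists
  have hz : ∀ j ∉ B, a j + t * w j = 0 := fun j hj => by simp [ha.eq_zero j hj, hB.eq_zero j hj]
  have hz' : ∀ j ∉ B', a' j + t * w' j = 0 :=
    fun j hj => by simp [ha'.eq_zero j hj, hB'.eq_zero j hj]
  have heq : a + t • w = a' + t • w' := by
    refine hB.isLexSimplex.eq_of_nonneg hB'.isLexSimplex (by simp [hU, hB.map_eq, hB'.map_eq])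
      (fun j => ?_) (fun j => ?_) (by simpa using hz) (by simpa using hz')
    · by_cases hj : j ∈ B
      · simpa using (ht j hj).le
      · simpa using (hz j hj).ge
    · by_cases hj : j ∈ B'
      · simpa using (ht' j hj).le
      · simpa using (hz' j hj).ge
  have hBB : B = B' := by
    ext j
    have hj : a j + t * w j = a' j + t * w' j := by simpa using congrFun heq j
    constructor
    · intro h
      by_contra h'
      exact (ht j h).ne' (hj.trans (hz' j h'))
    · intro h
      by_contra h'
      exact (ht' j h).ne' (hj.symm.trans (hz j h'))
  subst hBB
  exact ⟨rfl, hB.isLexSimplex.eq (hB.map_eq.trans hB'.map_eq.symm) hB.eq_zero hB'.eq_zero,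
    hB.isLexSimplex.eq hU ha.eq_zero ha'.eq_zero⟩

/-- The half-open cones of the maximal cells cover the image of the positive orthant. -/
theorem exists_isLexCell (hU : ∀ x, IsCompact {a : ι → ℝ | 0 ≤ a ∧ U a = x})
    {a : ι → ℝ} (ha : 0 ≤ a) :
    ∃ B w a', IsLexCell U B w ∧ IsHalfOpen B w a' ∧ U a' = U a := by
  have hrep : ∀ t : ℝ, ∃ B a', 0 < t → 0 ≤ a' ∧ U a' = U (a + t • 1) ∧ IsLexSimplex U B ∧
      ∀ j, a' j ≠ 0 ↔ j ∈ B := by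
    intro t
    by_cases ht : 0 < t
    · obtain ⟨B, a', h⟩ := exists_isLexSimplex_support hU (a := a + t • 1)
        (add_nonneg ha (smul_nonneg ht.le zero_le_one))
      exact ⟨B, a', fun _ => h⟩
    · exact ⟨∅, 0, fun h => absurd h ht⟩
  choose β r hr using hrep
  have hfreq : ∃ B, ∃ᶠ t in nhdsWithin (0 : ℝ) (Set.Ioi 0), β t = B := by
    by_contra! h
    obtain ⟨t, ht⟩ := (Filter.eventually_all.2 h).exists
    exact ht _ rfl
  obtain ⟨B, hfreq⟩ := hfreq
  have hfreq' := hfreq.and_eventually (self_mem_nhdsWithin (s := Set.Ioi (0 : ℝ)))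
  obtain ⟨t₁, ht₁B, ht₁⟩ := hfreq'.exists
  obtain ⟨t₂, ⟨ht₂B, ht₂⟩, ht₂₁⟩ := (hfreq'.and_eventually
    (Ioo_mem_nhdsGT (show (0 : ℝ) < t₁ from ht₁))).exists
  have hBs : IsLexSimplex U B := ht₁B ▸ (hr t₁ ht₁).2.2.1
  have hsupp : ∀ t, 0 < t → β t = B → ∀ j ∉ B, r t j = 0 := by
    intro t ht htB j hj
    by_contra h
    exact hj (htB ▸ ((hr t ht).2.2.2 j).1 h)
  have hne : t₁ - t₂ ≠ 0 := sub_ne_zero.2 ht₂₁.2.ne'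
  set w : ι → ℝ := (t₁ - t₂)⁻¹ • (r t₁ - r t₂) with hw
  have hwB : ∀ j ∉ B, w j = 0 := fun j hj => by
    simp [hw, hsupp t₁ ht₁ ht₁B j hj, hsupp t₂ ht₂ ht₂B j hj]
  have hwU : U w = U 1 := by
    have : U (r t₁) - U (r t₂) = (t₁ - t₂) • U 1 := by
      rw [(hr t₁ ht₁).2.1, (hr t₂ ht₂).2.1]
      simp [sub_smul]
    rw [hw, map_smul, map_sub, this, smul_smul, inv_mul_cancel₀ hne, one_smul]
  set b : ι → ℝ := r t₁ - t₁ • w with hb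
  have hbB : ∀ j ∉ B, b j = 0 := fun j hj => by simp [hb, hwB j hj, hsupp t₁ ht₁ ht₁B j hj]
  have hbU : U b = U a := by
    rw [hb, map_sub, map_smul, hwU, (hr t₁ ht₁).2.1]
    simp
  have hbt : ∀ t, 0 < t → β t = B → ∀ j ∈ B, 0 < b j + t * w j := by
    intro t ht htB j hj
    have : r t = b + t • w := hBs.eq (by simp [(hr t ht).2.1, hbU, hwU]) (hsupp t ht htB)
      fun j hj => by simp [hbB j hj, hwB j hj]
    have h2 : r t j = b j + t * w j := by simpa using congrFun this j
    rw [← h2]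
    exact lt_of_le_of_ne ((hr t ht).1 j) (Ne.symm (((hr t ht).2.2.2 j).2 (htB ▸ hj)))
  refine ⟨B, w, b, ⟨hBs, hwB, hwU⟩, ⟨hbB, fun j => ?_, fun j hj hwj => ?_⟩, hbU⟩
  · by_cases hj : j ∈ B
    · by_contra! hneg
      have hcont : Tendsto (fun t : ℝ => b j + t * w j) (nhdsWithin 0 (Set.Ioi 0))
          (nhds (b j)) := by
        have hcont : Continuous fun t : ℝ => b j + t * w j := by fun_prop
        simpa using (hcont.tendsto 0).mono_left nhdsWithin_le_nhds
      obtain ⟨t, ⟨htB, ht⟩, hlt⟩ :=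
        (hfreq'.and_eventually (hcont.eventually (gt_mem_nhds hneg))).exists
      exact absurd (hbt t ht htB j hj) (not_lt.2 hlt.le)
    · exact (hbB j hj).ge
  · have := hbt t₁ ht₁ ht₁B j hj
    nlinarith [mul_nonneg (le_of_lt ht₁) (neg_nonneg.2 hwj)]

end LexTriangulation

section Counting

/-- The number of compositions of `n - b` supported on a fixed set of more than `b` indices is
a polynomial in `n`, including for `n < b`. -/
theorem exists_polynomial_card_compositions {ι : Type*} [Fintype ι] [DecidableEq ι]
    (s : Finset ι) (b : ℕ) (hb : b < s.card) :
    ∃ p : Polynomial ℝ, ∀ n : ℕ,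
      p.eval (n : ℝ) = Nat.card {f : ι → ℕ // (∀ j ∉ s, f j = 0) ∧ ∑ j, f j + b = n} := by
  have hcard : ∀ n : ℕ, Nat.card {f : ι → ℕ // (∀ j ∉ s, f j = 0) ∧ ∑ j, f j + b = n} =
      (n + (s.card - 1 - b)).choose (s.card - 1) := by
    intro n
    rcases lt_or_ge n b with hn | hn
    · rw [Nat.choose_eq_zero_of_lt (by omega)]
      have : IsEmpty {f : ι → ℕ // (∀ j ∉ s, f j = 0) ∧ ∑ j, f j + b = n} :=
        ⟨fun f => by have := f.2.2; omega⟩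
      exact Nat.card_of_isEmpty
    · have e : {f : ι → ℕ // (∀ j ∉ s, f j = 0) ∧ ∑ j, f j + b = n} ≃
          s.finsuppAntidiag (n - b) := by
        refine (Finsupp.equivFunOnFinite.symm.subtypeEquiv fun f => ?_)
        have hsum : (∀ j ∉ s, f j = 0) → ∑ j, f j = ∑ j ∈ s, f j := fun h =>
          (Finset.sum_subset (Finset.subset_univ s) fun j _ hj => h j hj).symm
        have hsub : (Finsupp.equivFunOnFinite.symm f).support ⊆ s ↔ ∀ j ∉ s, f j = 0 := by
          simp only [Finset.subset_iff, Finsupp.mem_support_iff,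
            Finsupp.equivFunOnFinite_symm_apply_apply]
          exact forall_congr' fun j => by rw [not_imp_comm]
        rw [Finset.mem_finsuppAntidiag, hsub, and_comm]
        simp only [Finsupp.equivFunOnFinite_symm_apply_apply]
        refine and_congr_left fun h => ?_
        rw [hsum h]
        omega
      rw [Nat.card_congr e, Nat.card_eq_fintype_card, Fintype.card_coe,
        Finset.card_finsuppAntidiag_nat_eq_choose]
      rw [show s.card + (n - b) - 1 = (n - b) + (s.card - 1) by omega,
        show n + (s.card - 1 - b) = (n - b) + (s.card - 1) by omega, Nat.choose_symm_add]
  refine ⟨Polynomial.C (((s.card - 1).factorial : ℝ)⁻¹) *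
    (descPochhammer ℝ (s.card - 1)).comp (Polynomial.X + ((s.card - 1 - b : ℕ) : Polynomial ℝ)), fun n => ?_⟩
  have h0 : ((s.card - 1).factorial : ℝ) ≠ 0 := by positivity
  rw [hcard]
  simp only [Polynomial.eval_mul, Polynomial.eval_C, Polynomial.eval_comp, Polynomial.eval_add,
    Polynomial.eval_X, Polynomial.eval_natCast]
  rw [← Nat.cast_add, descPochhammer_eval_eq_descFactorial,
    Nat.descFactorial_eq_factorial_mul_choose, Nat.cast_mul, inv_mul_cancel_left₀ h0]

/-- Compositions graded by several levels split as a product over the levels. -/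
theorem card_graded_compositions {ι κ : Type*} [Fintype ι] [Fintype κ] [DecidableEq κ]
    [DecidableEq ι] (lev : ι → κ) (B : Finset ι) (b n : κ → ℕ) :
    Nat.card {c : ι → ℕ // (∀ j ∉ B, c j = 0) ∧ ∀ i, ∑ j with lev j = i, c j + b i = n i} =
      ∏ i, Nat.card {f : ι → ℕ //
        (∀ j ∉ B.filter fun j => lev j = i, f j = 0) ∧ ∑ j, f j + b i = n i} := by
  rw [← Nat.card_pi]
  refine Nat.card_congr
    { toFun c i := ⟨fun j => if lev j = i then c.1 j else 0, fun j hj => ?_, ?_⟩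
      invFun f := ⟨fun j => (f (lev j)).1 j, fun j hj => ?_, fun i => ?_⟩
      left_inv c := ?_
      right_inv f := ?_ }
  · by_cases h : lev j = i
    · simpa [h] using c.2.1 j fun hB => hj (by simp [hB, h])
    · simp [h]
  · rw [← Finset.sum_filter]
    exact c.2.2 i
  · exact (f (lev j)).2.1 j (by simp [hj])
  · rw [← (f i).2.2, Finset.sum_filter]
    congr 1
    refine Finset.sum_congr rfl fun j _ => ?_
    split_ifs with h
    · rw [h]
    · exact ((f i).2.1 j (by simp [h])).symm
  · ext j
    simp
  · ext i j
    by_cases h : lev j = i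
    · subst h; simp
    · simpa [h] using ((f i).2.1 j (by simp [h])).symm

end Counting

section CayleyCone

variable {ι : Type} [Fintype ι] {d k : ℕ}

/-- The linear map sending the basis vector of `j` to `(v j, e_{lev j})`, a generator of the
Cayley cone. -/
def cayleyMap (lev : ι → Fin k) (v : ι → Fin d → ℤ) :
    (ι → ℝ) →ₗ[ℝ] (Fin d → ℝ) × (Fin k → ℝ) where
  toFun a := (fun x => ∑ j, a j * v j x, fun i => ∑ j with lev j = i, a j)
  map_add' a b := by
    ext <;> simp [add_mul, Finset.sum_add_distrib]
  map_smul' r a := by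
    ext <;> simp [mul_assoc, Finset.mul_sum]

variable {lev : ι → Fin k} {v : ι → Fin d → ℤ}

theorem isCompact_cayleyMap_fiber (x : (Fin d → ℝ) × (Fin k → ℝ)) :
    IsCompact {a : ι → ℝ | 0 ≤ a ∧ cayleyMap lev v a = x} := by
  refine (isCompact_Icc (a := (0 : ι → ℝ)) (b := fun j => x.2 (lev j))).of_isClosed_subset
    (isClosed_Ici.inter (isClosed_singleton.preimage
      (cayleyMap lev v).continuous_of_finiteDimensional)) ?_
  rintro a ⟨ha, rfl⟩
  refine ⟨ha, fun j => ?_⟩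
  exact Finset.single_le_sum (f := a) (fun i _ => ha i) (by simp)

variable [LinearOrder ι]

/-- A lattice point in the half-open fundamental parallelepiped of a cell. -/
@[ext]
structure BoxPoint (lev : ι → Fin k) (v : ι → Fin d → ℤ) where
  /-- the generators of the cell -/
  B : Finset ι
  /-- the coordinates of the shift direction -/
  w : ι → ℝ
  /-- the coordinates of the box point -/
  β : ι → ℝ
  /-- the position of the box point -/
  y : Fin d → ℤ
  /-- the degree of the box point -/
  b : Fin k → ℕ
  isLexCell : IsLexCell (cayleyMap lev v) B w
  isHalfOpen : IsHalfOpen B w β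
  le_one : ∀ j, β j ≤ 1
  lt_one : ∀ j ∈ B, 0 < w j → β j < 1
  map_eq : cayleyMap lev v β = (fun x => (y x : ℝ), fun i => (b i : ℝ))

theorem BoxPoint.position_eq (t : BoxPoint lev v) (x : Fin d) :
    ∑ j, t.β j * v j x = t.y x := congrFun (congrArg Prod.fst t.map_eq) x

theorem BoxPoint.degree_eq (t : BoxPoint lev v) (i : Fin k) :
    ∑ j with lev j = i, t.β j = t.b i := congrFun (congrArg Prod.snd t.map_eq) i

instance : Finite (BoxPoint lev v) := by
  have hfin : (Set.Icc (fun x => - ∑ j, |v j x|) (fun x => ∑ j, |v j x|) ×ˢ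
      Set.Icc (0 : Fin k → ℕ) fun _ => Fintype.card ι).Finite :=
    (Set.finite_Icc _ _).prod (Set.finite_Icc _ _)
  have := hfin.to_subtype
  refine Finite.of_injective (β := ↥(Set.Icc (fun x => - ∑ j, |v j x|) (fun x => ∑ j, |v j x|) ×ˢ
      Set.Icc (0 : Fin k → ℕ) fun _ => Fintype.card ι)) (fun t => ⟨(t.y, t.b), ?_, ?_⟩) ?_
  · have habs : ∀ x, |t.y x| ≤ ∑ j, |v j x| := by
      intro x
      have h : |(t.y x : ℝ)| ≤ ∑ j, |(v j x : ℝ)| := by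
        rw [← t.position_eq]
        refine (Finset.abs_sum_le_sum_abs _ _).trans (Finset.sum_le_sum fun j _ => ?_)
        rw [abs_mul, abs_of_nonneg (t.isHalfOpen.nonneg j)]
        exact mul_le_of_le_one_left (abs_nonneg _) (t.le_one j)
      exact_mod_cast h
    exact ⟨fun x => (abs_le.1 (habs x)).1, fun x => (abs_le.1 (habs x)).2⟩
  · refine ⟨fun _ => Nat.zero_le _, fun i => ?_⟩
    have h : (t.b i : ℝ) ≤ Fintype.card ι := by
      rw [← t.degree_eq]
      calc ∑ j with lev j = i, t.β j ≤ ∑ j, t.β j :=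
            Finset.sum_le_sum_of_subset_of_nonneg (Finset.subset_univ _)
              fun j _ _ => t.isHalfOpen.nonneg j
        _ ≤ ∑ j : ι, 1 := Finset.sum_le_sum fun j _ => t.le_one j
        _ = Fintype.card ι := by simp
    exact_mod_cast h
  · intro t t' h
    have hy : t.y = t'.y := congrArg (fun p => p.1.1) h
    have hb : t.b = t'.b := congrArg (fun p => p.1.2) h
    obtain ⟨h1, h2, h3⟩ := t.isLexCell.unique t'.isLexCell t.isHalfOpen t'.isHalfOpen
      (by rw [t.map_eq, t'.map_eq, hy, hb])
    exact BoxPoint.ext h1 h2 h3 hy hb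

theorem BoxPoint.degree_lt (hlev : Function.Surjective lev) (t : BoxPoint lev v) (i : Fin k) :
    t.b i < (t.B.filter fun j => lev j = i).card := by
  have hw : ∑ j with lev j = i, t.w j = ∑ j with lev j = i, (1 : ℝ) :=
    congrFun (congrArg Prod.snd t.isLexCell.map_eq) i
  obtain ⟨j₀, hj₀⟩ := hlev i
  have hpos : 0 < ∑ j with lev j = i, t.w j := by
    rw [hw]
    exact Finset.sum_pos (fun _ _ => one_pos) ⟨j₀, by simpa using hj₀⟩
  obtain ⟨j, hj, hwj⟩ : ∃ j ∈ Finset.univ.filter fun j => lev j = i, 0 < t.w j := by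
    by_contra! h
    exact absurd hpos (not_lt.2 (Finset.sum_nonpos h))
  have hjB : j ∈ t.B := by
    by_contra h
    exact hwj.ne' (t.isLexCell.eq_zero j h)
  have hji : lev j = i := by simpa using hj
  have hsum : ∑ j with lev j = i, t.β j = ∑ j ∈ t.B.filter fun j => lev j = i, t.β j := by
    refine (Finset.sum_subset (fun l hl => ?_) fun l hl hl' => ?_).symm
    · simpa using (Finset.mem_filter.1 hl).2
    · refine t.isHalfOpen.eq_zero l fun hB => hl' ?_
      exact Finset.mem_filter.2 ⟨hB, by simpa using hl⟩
  have h : (t.b i : ℝ) < ((t.B.filter fun j => lev j = i).card : ℝ) := by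
    rw [← t.degree_eq, hsum, ← nsmul_one, ← Finset.sum_const]
    exact Finset.sum_lt_sum (fun l _ => t.le_one l)
      ⟨j, Finset.mem_filter.2 ⟨hjB, hji⟩, t.lt_one j hjB hwj⟩
  exact_mod_cast h

/-- Every lattice point of the Cayley cone is uniquely a box point plus a nonnegative integral
combination of the generators of its cell. -/
theorem card_cayley_lattice_points (n : Fin k → ℕ) :
    Nat.card {z : Fin d → ℤ // ∃ a, 0 ≤ a ∧
      cayleyMap lev v a = (fun x => (z x : ℝ), fun i => (n i : ℝ))} =
    Nat.card (Σ t : BoxPoint lev v, {c : ι → ℕ //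
      (∀ j ∉ t.B, c j = 0) ∧ ∀ i, ∑ j with lev j = i, c j + t.b i = n i}) := by
  symm
  have hmap : ∀ (t : BoxPoint lev v) (c : ι → ℕ),
      (∀ i, ∑ j with lev j = i, c j + t.b i = n i) →
      cayleyMap lev v (t.β + fun j => (c j : ℝ)) =
        (fun x => ((t.y x + ∑ j, c j * v j x : ℤ) : ℝ), fun i => (n i : ℝ)) := by
    intro t c hc
    rw [map_add, t.map_eq]
    refine Prod.ext (funext fun x => ?_) (funext fun i => ?_)
    · simp [cayleyMap]
    · simp [cayleyMap, ← hc i, add_comm]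
  have hopen : ∀ (t : BoxPoint lev v) (c : ι → ℕ), (∀ j ∉ t.B, c j = 0) →
      IsHalfOpen t.B t.w (t.β + fun j => (c j : ℝ)) := fun t c hc =>
    ⟨fun j hj => by simp [hc j hj, t.isHalfOpen.eq_zero j hj],
      fun j => add_nonneg (t.isHalfOpen.nonneg j) (Nat.cast_nonneg _),
      fun j hj hw => add_pos_of_pos_of_nonneg (t.isHalfOpen.pos j hj hw) (Nat.cast_nonneg _)⟩
  refine Nat.card_congr (Equiv.ofBijective (fun p =>
    ⟨fun x => p.1.y x + ∑ j, p.2.1 j * v j x, p.1.β + fun j => (p.2.1 j : ℝ), fun j =>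
      (hopen p.1 p.2.1 p.2.2.1).nonneg j, hmap p.1 p.2.1 p.2.2.2⟩) ⟨?_, ?_⟩)
  · rintro ⟨t, c, hc, hcn⟩ ⟨t', c', hc', hcn'⟩ h
    have hz := congrArg Subtype.val h
    simp only at hz
    obtain ⟨h1, h2, h3⟩ := t.isLexCell.unique t'.isLexCell (hopen t c hc) (hopen t' c' hc') (by
      rw [hmap t c hcn, hmap t' c' hcn']
      refine Prod.ext (funext fun x => ?_) rfl
      exact congrArg (Int.cast : ℤ → ℝ) (congrFun hz x))
    have hcc : c = c' := by
      funext j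
      have hj : t.β j + c j = t'.β j + c' j := congrFun h3 j
      by_cases hjB : j ∈ t.B
      · have hjB' : j ∈ t'.B := h1 ▸ hjB
        have hlt : |((c j : ℤ) - (c' j : ℤ) : ℤ)| < 1 := by
          have : |((c j : ℝ) - (c' j : ℝ))| < 1 := by
            rw [show (c j : ℝ) - c' j = t'.β j - t.β j by linarith, abs_lt]
            rcases lt_or_ge 0 (t.w j) with hw | hw
            · have := t.lt_one j hjB hw
              have := t'.lt_one j hjB' (h2 ▸ hw)
              have := t.isHalfOpen.nonneg j
              have := t'.isHalfOpen.nonneg j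
              constructor <;> linarith
            · have := t.isHalfOpen.pos j hjB hw
              have := t'.isHalfOpen.pos j hjB' (h2 ▸ hw)
              have := t.le_one j
              have := t'.le_one j
              constructor <;> linarith
          exact_mod_cast this
        rw [Int.abs_lt_one_iff] at hlt
        omega
      · rw [hc j hjB, hc' j (h1 ▸ hjB)]
    subst hcc
    have hβ : t.β = t'.β := add_right_cancel h3
    have ht : t = t' := by
      refine BoxPoint.ext h1 h2 hβ (funext fun x => ?_) (funext fun i => ?_)
      · exact add_right_cancel (congrFun hz x)
      · exact add_left_cancel ((hcn i).trans (hcn' i).symm)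
    subst ht
    rfl
  · rintro ⟨z, a₀, ha₀, hz⟩
    obtain ⟨B, w, a, hB, ha, hU⟩ := exists_isLexCell isCompact_cayleyMap_fiber ha₀
    rw [hz] at hU
    have hUx : ∀ x, ∑ j, a j * v j x = z x := congrFun (congrArg Prod.fst hU)
    have hUi : ∀ i, ∑ j with lev j = i, a j = n i := congrFun (congrArg Prod.snd hU)
    have hfrac : ∀ j, ∃ m : ℕ, 0 ≤ a j - m ∧ a j - m ≤ 1 ∧ (j ∉ B → m = 0) ∧
        (0 < w j → a j - m < 1) ∧ (j ∈ B → w j ≤ 0 → 0 < a j - m) := by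
      intro j
      by_cases hj : j ∈ B
      · rcases lt_or_ge 0 (w j) with hw | hw
        · have h1 := Nat.floor_le (ha.nonneg j)
          have h2 := Nat.lt_floor_add_one (a j)
          exact ⟨⌊a j⌋₊, by linarith, by linarith, fun h => absurd hj h, fun _ => by linarith,
            fun _ h => absurd hw (not_lt.2 h)⟩
        · have hpos := ha.pos j hj hw
          have h0 : 0 < ⌈a j⌉₊ := Nat.ceil_pos.2 hpos
          have h1 := Nat.le_ceil (a j)
          have h2 := Nat.ceil_lt_add_one (ha.nonneg j)
          have h3 : ((⌈a j⌉₊ - 1 : ℕ) : ℝ) = ⌈a j⌉₊ - 1 := by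
            rw [Nat.cast_sub h0, Nat.cast_one]
          exact ⟨⌈a j⌉₊ - 1, by linarith, by linarith, fun h => absurd hj h,
            fun h => absurd h (not_lt.2 hw), fun _ _ => by linarith⟩
      · exact ⟨0, by simp [ha.eq_zero j hj], by simp [ha.eq_zero j hj], fun _ => rfl,
          fun _ => by simp [ha.eq_zero j hj], fun h => absurd h hj⟩
    choose c hc0 hc1 hcB hclt hcpos using hfrac
    have hcn : ∀ i, ∑ j with lev j = i, c j ≤ n i := by
      intro i
      have : ((∑ j with lev j = i, c j : ℕ) : ℝ) ≤ n i := by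
        rw [← hUi, Nat.cast_sum]
        exact Finset.sum_le_sum fun j _ => by linarith [hc0 j]
      exact_mod_cast this
    refine ⟨⟨⟨B, w, fun j => a j - c j, fun x => z x - ∑ j, c j * v j x,
      fun i => n i - ∑ j with lev j = i, c j, hB, ⟨fun j hj => ?_, hc0, hcpos⟩, hc1,
      fun j _ => hclt j, ?_⟩, c, fun j hj => hcB j hj, fun i => ?_⟩, ?_⟩
    · simp [hcB j hj, ha.eq_zero j hj]
    · refine Prod.ext (funext fun x => ?_) (funext fun i => ?_)
      · simp [cayleyMap, sub_mul, hUx]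
      · simp [cayleyMap, hUi, Nat.cast_sub (hcn i)]
    · exact Nat.add_sub_cancel' (hcn i)
    · ext x
      simp

/-- The number of lattice points of the Cayley cone of multidegree `n` is a sum of products of
univariate polynomials in the coordinates of `n`. -/
theorem exists_polynomial_card_cayley (hlev : Function.Surjective lev) (v : ι → Fin d → ℤ) :
    ∃ (T : Type) (_ : Fintype T) (g : T → Fin k → Polynomial ℝ), ∀ n : Fin k → ℕ,
      (Nat.card {z : Fin d → ℤ // ∃ a, 0 ≤ a ∧
        cayleyMap lev v a = (fun x => (z x : ℝ), fun i => (n i : ℝ))} : ℝ) =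
      ∑ t, ∏ i, (g t i).eval (n i : ℝ) := by
  choose g hg using fun (t : BoxPoint lev v) (i : Fin k) =>
    exists_polynomial_card_compositions _ _ (t.degree_lt hlev i)
  have := Fintype.ofFinite (BoxPoint lev v)
  refine ⟨BoxPoint lev v, this, g, fun n => ?_⟩
  have hfin : ∀ t : BoxPoint lev v, Finite {c : ι → ℕ //
      (∀ j ∉ t.B, c j = 0) ∧ ∀ i, ∑ j with lev j = i, c j + t.b i = n i} := by
    intro t
    refine ((Set.finite_Icc (0 : ι → ℕ) fun j => n (lev j)).subset ?_).to_subtype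
    rintro c ⟨-, hc⟩
    refine ⟨fun _ => Nat.zero_le _, fun j => ?_⟩
    have := Finset.single_le_sum (f := c) (s := Finset.univ.filter fun l => lev l = lev j)
      (fun _ _ => Nat.zero_le _) (a := j) (by simp)
    exact this.trans ((Nat.le_add_right _ _).trans (hc (lev j)).le)
  rw [card_cayley_lattice_points, Nat.card_sigma, Nat.cast_sum]
  refine Finset.sum_congr rfl fun t _ => ?_
  rw [card_graded_compositions, Nat.cast_prod]
  exact Finset.prod_congr rfl fun i _ => (hg t i (n i)).symm

end CayleyCone

section MinkowskiSums

variable {d : ℕ}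

theorem mem_smul_convexHull_lattice {V : Finset (Fin d → ℤ)} (hV : V.Nonempty) {m : ℝ}
    (hm : 0 ≤ m) {x : Fin d → ℝ} :
    x ∈ m • convexHull ℝ ((fun z : Fin d → ℤ => fun i => (z i : ℝ)) '' ↑V) ↔
      ∃ a : V → ℝ, 0 ≤ a ∧ ∑ z, a z = m ∧ ∀ i, ∑ z, a z * (z.1 i : ℝ) = x i := by
  set f : (Fin d → ℤ) → Fin d → ℝ := fun z i => (z i : ℝ) with hf
  have hinj : Function.Injective f := fun z z' h =>
    funext fun i => Int.cast_injective (congrFun h i)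
  constructor
  · rintro ⟨p, hp, rfl⟩
    rw [← Finset.coe_image, Finset.mem_convexHull'] at hp
    obtain ⟨w, hw0, hw1, hwp⟩ := hp
    rw [Finset.sum_image hinj.injOn] at hw1 hwp
    refine ⟨fun z => m * w (f z), fun z =>
      mul_nonneg hm (hw0 _ (Finset.mem_image_of_mem f z.2)), ?_, fun i => ?_⟩
    · rw [← Finset.mul_sum, Finset.sum_coe_sort V fun z => w (f z), hw1, mul_one]
    · have hi : ∑ z ∈ V, w (f z) * (z i : ℝ) = p i := by
        simpa [hf] using congrFun hwp i
      simp only [mul_assoc, ← Finset.mul_sum]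
      rw [Finset.sum_coe_sort V fun z => w (f z) * (z i : ℝ), hi]
      simp
  · rintro ⟨a, ha0, ham, hax⟩
    rcases hm.eq_or_lt with rfl | hm
    · obtain ⟨z₀, hz₀⟩ := hV
      have ha : ∀ z, a z = 0 := fun z =>
        (Finset.sum_eq_zero_iff_of_nonneg fun z _ => ha0 z).1 ham z (Finset.mem_univ _)
      refine ⟨f z₀, subset_convexHull ℝ _ ⟨z₀, hz₀, rfl⟩, ?_⟩
      ext i
      simp [← hax i, ha]
    · refine ⟨∑ z, (m⁻¹ * a z) • f z, (convex_convexHull ℝ _).sum_mem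
        (fun z _ => mul_nonneg (inv_nonneg.2 hm.le) (ha0 z)) ?_
        (fun z _ => subset_convexHull ℝ _ ⟨z, z.2, rfl⟩), ?_⟩
      · rw [← Finset.mul_sum, ham, inv_mul_cancel₀ hm.ne']
      · ext i
        simp only [← hax i, Pi.smul_apply, Finset.sum_apply, smul_eq_mul, Finset.mul_sum, hf]
        refine Finset.sum_congr rfl fun z _ => ?_
        field_simp

/-- **Cayley trick** for dilated Minkowski sums of lattice polytopes. -/
theorem mem_sum_smul_convexHull_iff {k : ℕ} {V : Fin k → Finset (Fin d → ℤ)}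
    (hV : ∀ i, (V i).Nonempty) (n : Fin k → ℕ) (x : Fin d → ℝ) :
    x ∈ ∑ i, (n i : ℝ) • convexHull ℝ ((fun z : Fin d → ℤ => fun i => (z i : ℝ)) '' ↑(V i)) ↔
      ∃ a : (Σ i, V i) → ℝ, 0 ≤ a ∧
        cayleyMap Sigma.fst (fun p : Σ i, V i => p.2.1) a = (x, fun i => (n i : ℝ)) := by
  have hlevel : ∀ (a : (Σ i, V i) → ℝ) (i : Fin k),
      ∑ p with Sigma.fst p = i, a p = ∑ z, a ⟨i, z⟩ := by
    intro a i
    rw [Finset.sum_filter, Fintype.sum_sigma, Finset.sum_eq_single i]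
    · simp
    · intro j _ hj
      simp [hj]
    · simp
  rw [Set.mem_finsetSum]
  constructor
  · rintro ⟨g, hg, rfl⟩
    choose a ha0 ham hax using fun i =>
      (mem_smul_convexHull_lattice (hV i) (Nat.cast_nonneg _)).1 (hg (Finset.mem_univ i))
    refine ⟨fun p => a p.1 p.2, fun p => ha0 p.1 p.2, Prod.ext (funext fun l => ?_)
      (funext fun i => (hlevel _ i).trans (ham i))⟩
    simp only [cayleyMap, LinearMap.coe_mk, AddHom.coe_mk, Fintype.sum_sigma, Finset.sum_apply]
    exact Finset.sum_congr rfl fun i _ => hax i l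
  · rintro ⟨a, ha0, ha⟩
    refine ⟨fun i l => ∑ z : V i, a ⟨i, z⟩ * (z.1 l : ℝ), fun {i} _ => ?_, ?_⟩
    · exact (mem_smul_convexHull_lattice (hV i) (Nat.cast_nonneg _)).2
        ⟨fun z => a ⟨i, z⟩, fun z => ha0 _,
          (hlevel a i).symm.trans (congrFun (congrArg Prod.snd ha) i), fun _ => rfl⟩
    · ext l
      have h : ∑ p : (Σ i, V i), a p * (p.2.1 l : ℝ) = x l := congrFun (congrArg Prod.fst ha) l
      rw [← h, Fintype.sum_sigma, Finset.sum_apply]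

/-- The number of lattice points of `∑ i, n i • P i` is a sum of products of univariate
polynomials in the `n i`, for all natural numbers `n i`. -/
theorem exists_polynomial_latticePointCount {k : ℕ} {P : Fin k → Set (Fin d → ℝ)}
    (hP : ∀ i, IsLatticePolytope (P i)) :
    ∃ (T : Type) (_ : Fintype T) (g : T → Fin k → Polynomial ℝ), ∀ n : Fin k → ℕ,
      (latticePointCount (∑ i, (n i : ℝ) • P i) : ℝ) = ∑ t, ∏ i, (g t i).eval (n i : ℝ) := by
  choose V hV hPV using hP
  let _ : LinearOrder (Σ i, V i) :=
    LinearOrder.lift' (Fintype.equivFin (Σ i, V i)) (Equiv.injective _)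
  have hlev : Function.Surjective (Sigma.fst : (Σ i, V i) → Fin k) := fun i =>
    ⟨⟨i, (hV i).choose, (hV i).choose_spec⟩, rfl⟩
  obtain ⟨T, hT, g, hg⟩ := exists_polynomial_card_cayley hlev fun p : Σ i, V i => p.2.1
  refine ⟨T, hT, g, fun n => ?_⟩
  rw [← hg n, latticePointCount, ← Nat.card_coe_set_eq]
  congr 1
  refine Nat.card_congr (Equiv.subtypeEquivRight fun z => ?_)
  simp only [← mem_sum_smul_convexHull_iff hV, ← hPV]
  rfl

end MinkowskiSums

/-- **Vanishing of low-order mixed Ehrhart coefficients.**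
For lattice polytopes `P_1, …, P_k ⊆ ℝ^d` with mixed Ehrhart polynomial `M`,
the coefficient of `n^i` vanishes for all `i < k`; equivalently `n^k` divides `M`. -/
theorem mixed_ehrhart_coeff_eq_zero_of_lt
    {d k : ℕ} (P : Fin k → Set (Fin d → ℝ))
    (hP : ∀ i, IsLatticePolytope (P i))
    (M : Polynomial ℝ) (hMdeg : M.natDegree ≤ d)
    (hM : ∀ n : ℕ, M.eval (n : ℝ) = (DMV (fun i => (n : ℝ) • P i) : ℝ)) :
    (∀ i < k, M.coeff i = 0) ∧ Polynomial.X ^ k ∣ M := by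
  obtain ⟨T, _, g, hg⟩ := exists_polynomial_latticePointCount hP
  have hsum : ∀ (n : ℕ) (J : Finset (Fin k)), ∑ j ∈ J, (n : ℝ) • P j =
      ∑ j, ((if j ∈ J then n else 0 : ℕ) : ℝ) • P j := by
    intro n J
    rw [← Finset.sum_subset (Finset.subset_univ J) fun j _ hj => ?_]
    · exact Finset.sum_congr rfl fun j hj => by simp [hj]
    · obtain ⟨V, hV, hPV⟩ := hP j
      have : (P j).Nonempty := hPV ▸ (hV.to_set.image _).convexHull
      rw [if_neg hj, Nat.cast_zero, Set.zero_smul_set this]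
  have hMR : M = ∑ t, ∏ i, (g t i - Polynomial.C ((g t i).eval 0)) := by
    refine Polynomial.eq_of_infinite_eval_eq _ _
      ((Set.infinite_range_of_injective (Nat.cast_injective (R := ℝ))).mono ?_)
    rintro _ ⟨n, rfl⟩
    simp only [Set.mem_ofPred_eq, hM, DMV, Polynomial.eval_finsetSum, Polynomial.eval_prod,
      Polynomial.eval_sub, Polynomial.eval_C, Int.cast_sum, Int.cast_mul, Int.cast_pow,
      Int.cast_neg, Int.cast_one, Int.cast_natCast, hsum, hg, Finset.mul_sum]
    rw [Finset.sum_comm]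
    refine Finset.sum_congr rfl fun t _ => ?_
    simp only [sub_eq_add_neg]
    rw [Fintype.prod_add]
    refine Finset.sum_congr rfl fun J _ => ?_
    rw [← Finset.prod_mul_prod_compl J, Finset.prod_neg, Finset.card_compl, Fintype.card_fin,
      Finset.prod_congr rfl fun i (hi : i ∈ J) => by rw [if_pos hi],
      Finset.prod_congr rfl fun i (hi : i ∈ Jᶜ) => by
        rw [if_neg (Finset.mem_compl.1 hi), Nat.cast_zero]]
    ring
  have hdvd : Polynomial.X ^ k ∣ M := by
    rw [hMR]
    refine Finset.dvd_sum fun t _ => ?_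
    have : (Polynomial.X : Polynomial ℝ) ^ k = ∏ _i : Fin k, Polynomial.X := by simp
    rw [this]
    refine Finset.prod_dvd_prod_of_dvd _ _ fun i _ => ?_
    rw [Polynomial.X_dvd_iff]
    simp [Polynomial.coeff_zero_eq_eval_zero]
  exact ⟨Polynomial.X_pow_dvd_iff.1 hdvd, hdvd⟩
end

section
/- (Bernstein) Let P_1, …, P_d be d lattice polytopes in ℝ^d such that P_1 + ⋯ + P_d is d-dimensional. Then the mixed Ehrhart polynomial satisfies ME_{P_1,…,P_d}(n) = c · n^d for all n, where c is the coefficient of n_1 n_2 ⋯ n_d in the volume polynomial V of (P_1,…,P_d), i.e., c = d! · MV_d(P_1,…,P_d). -/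
open Pointwise MeasureTheory Filter
open scoped Classical

/-- The Euler characteristic of a convex set: `1` if it is nonempty and `0` otherwise. -/
noncomputable def convexEuler {E : Type*} (C : Set E) : ℤ := if C.Nonempty then 1 else 0

theorem convexEuler_add_hyperplane {E : Type*} [AddCommGroup E] [Module ℝ E] {C : Set E}
    (hC : Convex ℝ C) (g : E →ᵃ[ℝ] ℝ) :
    convexEuler C + convexEuler (C ∩ {x | g x = 0}) =
      convexEuler (C ∩ {x | 0 ≤ g x}) + convexEuler (C ∩ {x | g x ≤ 0}) := by
  have key : (C ∩ {x | 0 ≤ g x}).Nonempty → (C ∩ {x | g x ≤ 0}).Nonempty →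
      (C ∩ {x | g x = 0}).Nonempty := by
    rintro ⟨x, hx, hx0⟩ ⟨y, hy, hy0⟩
    simp only [Set.mem_ofPred_eq] at hx0 hy0
    rcases eq_or_ne (g x) 0 with h | h
    · exact ⟨x, hx, h⟩
    have hpos : 0 < g x - g y := by
      have : 0 < g x := lt_of_le_of_ne hx0 h.symm
      linarith
    refine ⟨AffineMap.lineMap x y (g x / (g x - g y)),
      hC.lineMap_mem hx hy ⟨by positivity, ?_⟩, ?_⟩
    · rw [div_le_one hpos]; linarith
    · simp only [Set.mem_ofPred_eq, AffineMap.apply_lineMap, AffineMap.lineMap_apply_ring']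
      field_simp
      ring
  have h1 : (C ∩ {x | g x = 0}).Nonempty → (C ∩ {x | 0 ≤ g x}).Nonempty := by
    rintro ⟨x, hx, h⟩
    exact ⟨x, hx, h.ge⟩
  have h2 : (C ∩ {x | g x = 0}).Nonempty → (C ∩ {x | g x ≤ 0}).Nonempty := by
    rintro ⟨x, hx, h⟩
    exact ⟨x, hx, h.le⟩
  have h3 : C.Nonempty ↔ (C ∩ {x | 0 ≤ g x}).Nonempty ∨ (C ∩ {x | g x ≤ 0}).Nonempty := by
    constructor
    · rintro ⟨x, hx⟩
      rcases le_total 0 (g x) with h | h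
      · exact Or.inl ⟨x, hx, h⟩
      · exact Or.inr ⟨x, hx, h⟩
    · rintro (⟨x, hx, -⟩ | ⟨x, hx, -⟩) <;> exact ⟨x, hx⟩
  unfold convexEuler
  by_cases ha : (C ∩ {x | 0 ≤ g x}).Nonempty <;> by_cases hb : (C ∩ {x | g x ≤ 0}).Nonempty <;>
    by_cases hc : (C ∩ {x | g x = 0}).Nonempty <;> simp_all

theorem convex_affine_nonneg {E : Type*} [AddCommGroup E] [Module ℝ E] (g : E →ᵃ[ℝ] ℝ) :
    Convex ℝ {x | 0 ≤ g x} :=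
  (convex_Ici (0 : ℝ)).affine_preimage g

theorem convex_affine_nonpos {E : Type*} [AddCommGroup E] [Module ℝ E] (g : E →ᵃ[ℝ] ℝ) :
    Convex ℝ {x | g x ≤ 0} :=
  (convex_Iic (0 : ℝ)).affine_preimage g

theorem convex_affine_eq_zero {E : Type*} [AddCommGroup E] [Module ℝ E] (g : E →ᵃ[ℝ] ℝ) :
    Convex ℝ {x | g x = 0} :=
  (convex_singleton (0 : ℝ)).affine_preimage g

/-- If a point `y` of a convex set lies strictly on one side of `g`, and that side is covered by
the half-spaces `0 ≤ f i`, then so is its closure in the convex set. -/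
theorem exists_nonneg_of_cover_neg {E ι : Type*} [AddCommGroup E] [Module ℝ E] {C : Set E}
    (hC : Convex ℝ C) (g : E →ᵃ[ℝ] ℝ) (s : Finset ι) (f : ι → E →ᵃ[ℝ] ℝ)
    (hcov : ∀ x ∈ C, g x < 0 → ∃ i ∈ s, 0 ≤ f i x) {x y : E} (hx : x ∈ C) (hy : y ∈ C)
    (hgx : g x ≤ 0) (hgy : g y < 0) : ∃ i ∈ s, 0 ≤ f i x := by
  by_contra! h
  have hev : ∀ i ∈ s, ∀ᶠ t : ℝ in nhdsWithin 0 (Set.Ioi 0),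
      f i (AffineMap.lineMap x y t) < 0 := by
    intro i hi
    have hcont : ContinuousAt (fun t : ℝ => f i (AffineMap.lineMap x y t)) 0 := by
      simp only [AffineMap.apply_lineMap, AffineMap.lineMap_apply_ring']
      fun_prop
    exact (hcont.eventually_lt continuousAt_const (by simpa using h i hi)).filter_mono
      nhdsWithin_le_nhds
  have h1 := (Filter.eventually_all_finset s).2 hev
  have h2 : ∀ᶠ t : ℝ in nhdsWithin 0 (Set.Ioi 0), t ∈ Set.Ioc (0 : ℝ) 1 :=
    Ioc_mem_nhdsGT one_pos
  obtain ⟨t, ht, ht0, ht1⟩ := (h1.and h2).exists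
  obtain ⟨i, hi, hi0⟩ := hcov (AffineMap.lineMap x y t) (hC.lineMap_mem hx hy ⟨ht0.le, ht1⟩) (by
    rw [AffineMap.apply_lineMap, AffineMap.lineMap_apply_ring']
    nlinarith [mul_nonneg (sub_nonneg.2 ht1) (neg_nonneg.2 hgx),
      mul_pos ht0 (neg_pos.2 hgy)])
  exact absurd (ht i hi) (not_lt.2 hi0)

/-- Inclusion-exclusion for the Euler characteristic of a convex set covered by finitely many
half-spaces. -/
theorem sum_powerset_convexEuler_eq_zero {E ι : Type*} [AddCommGroup E] [Module ℝ E]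
    (f : ι → E →ᵃ[ℝ] ℝ) (s : Finset ι) :
    ∀ C : Set E, Convex ℝ C → (∀ x ∈ C, ∃ i ∈ s, 0 ≤ f i x) →
      ∑ I ∈ s.powerset, (-1) ^ I.card * convexEuler (C ∩ {x | ∀ i ∈ I, 0 ≤ f i x}) = 0 := by
  induction s using Finset.induction_on with
  | empty =>
    intro C _ hcov
    have : C = ∅ := Set.eq_empty_of_forall_notMem fun x hx => by simpa using hcov x hx
    simp [this, convexEuler]
  | insert a s ha ih =>
    intro C hC hcov
    rw [Finset.sum_powerset_insert ha]
    have hins : ∀ I ∈ s.powerset,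
        (-1 : ℤ) ^ (insert a I).card *
            convexEuler (C ∩ {x | ∀ i ∈ insert a I, 0 ≤ f i x}) =
          -((-1) ^ I.card *
            convexEuler ((C ∩ {x | 0 ≤ f a x}) ∩ {x | ∀ i ∈ I, 0 ≤ f i x})) := by
      intro I hI
      have haI : a ∉ I := fun h => ha (Finset.mem_powerset.1 hI h)
      have hset : C ∩ {x | ∀ i ∈ insert a I, 0 ≤ f i x} =
          (C ∩ {x | 0 ≤ f a x}) ∩ {x | ∀ i ∈ I, 0 ≤ f i x} := by
        ext x
        simp [and_assoc]
      rw [Finset.card_insert_of_notMem haI, hset, pow_succ]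
      ring
    rw [Finset.sum_congr rfl hins]
    by_cases hneg : ∃ y ∈ C, f a y < 0
    · obtain ⟨y, hy, hya⟩ := hneg
      have hcov' : ∀ x ∈ C, f a x < 0 → ∃ i ∈ s, 0 ≤ f i x := by
        intro x hx hxa
        obtain ⟨i, hi, hi0⟩ := hcov x hx
        rcases Finset.mem_insert.1 hi with rfl | hi
        · exact absurd hi0 (not_le.2 hxa)
        · exact ⟨i, hi, hi0⟩
      have h1 := ih (C ∩ {x | f a x ≤ 0}) (hC.inter (convex_affine_nonpos _))
        fun x hx => exists_nonneg_of_cover_neg hC (f a) s f hcov' hx.1 hy hx.2 hya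
      have h2 := ih (C ∩ {x | f a x = 0}) (hC.inter (convex_affine_eq_zero _))
        fun x hx => exists_nonneg_of_cover_neg hC (f a) s f hcov' hx.1 hy (le_of_eq hx.2) hya
      rw [← sub_eq_zero.2 (h1.trans h2.symm), ← Finset.sum_add_distrib, ← Finset.sum_sub_distrib]
      refine Finset.sum_congr rfl fun I _ => ?_
      have hI : Convex ℝ (C ∩ {x | ∀ i ∈ I, 0 ≤ f i x}) := by
        refine hC.inter ?_
        simp only [Set.ofPred_forall]
        exact convex_iInter₂ fun i _ => convex_affine_nonneg _
      have := convexEuler_add_hyperplane hI (f a)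
      simp only [Set.inter_right_comm _ {x | ∀ i ∈ I, 0 ≤ f i x}] at this
      linear_combination (-1) ^ I.card * this
    · push Not at hneg
      have hCa : C ∩ {x | 0 ≤ f a x} = C := Set.inter_eq_left.2 fun x hx => hneg x hx
      rw [hCa, Finset.sum_neg_distrib, add_neg_cancel]

theorem mem_smul_convexHull_range {F ι : Type*} [AddCommGroup F] [Module ℝ F] [Fintype ι]
    [Nonempty ι] (v : ι → F) {c : ℝ} (hc : 0 ≤ c) {y : F} :
    y ∈ c • convexHull ℝ (Set.range v) ↔
      ∃ w : ι → ℝ, (∀ i, 0 ≤ w i) ∧ ∑ i, w i = c ∧ ∑ i, w i • v i = y := by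
  have hull : convexHull ℝ (Set.range v) =
      Fintype.linearCombination ℝ v '' stdSimplex ℝ ι := by
    rw [← convexHull_basis_eq_stdSimplex, LinearMap.image_convexHull, ← Set.range_comp]
    congr 2
    ext i
    simp [Fintype.linearCombination_apply]
  rw [hull, Set.mem_smul_set]
  constructor
  · rintro ⟨_, ⟨w, ⟨hw0, hw1⟩, rfl⟩, rfl⟩
    refine ⟨c • w, fun i => mul_nonneg hc (hw0 i), ?_, ?_⟩
    · simp [← Finset.mul_sum, hw1]
    · simp [Fintype.linearCombination_apply, Finset.smul_sum, mul_smul]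
  · rintro ⟨w, hw0, hw1, rfl⟩
    rcases hc.eq_or_lt with rfl | hpos
    · have hw : w = 0 := by
        ext i
        exact (Finset.sum_eq_zero_iff_of_nonneg fun i _ => hw0 i).1 hw1 i (Finset.mem_univ i)
      obtain ⟨i⟩ := ‹Nonempty ι›
      exact ⟨_, ⟨Pi.single i 1, single_mem_stdSimplex ℝ i, rfl⟩, by simp [hw]⟩
    · refine ⟨_, ⟨c⁻¹ • w, ⟨fun i => mul_nonneg (inv_nonneg.2 hc) (hw0 i), ?_⟩, rfl⟩, ?_⟩
      · simp [← Finset.mul_sum, hw1, hpos.ne']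
      · rw [← map_smul, smul_inv_smul₀ hpos.ne', Fintype.linearCombination_apply]

/-- The relation `∏ i, ([Q] - [v i]) = 0` in the ring of convex sets under Minkowski addition,
where `Q` is the convex hull of the points `v i`, multiplied by the class of a convex set `R` and
evaluated at a point `x`. -/
theorem sum_indicator_minkowski_eq_zero {F ι : Type*} [AddCommGroup F] [Module ℝ F] [Fintype ι]
    [Nonempty ι] (v : ι → F) {R : Set F} (hR : Convex ℝ R) (x : F) :
    ∑ I : Finset ι, (-1 : ℤ) ^ I.card *
      (if x - ∑ i ∈ I, v i ∈ R + ((Fintype.card ι - I.card : ℕ) : ℝ) • convexHull ℝ (Set.range v)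
        then 1 else 0) = 0 := by
  set N := Fintype.card ι with hN
  let C : Set (ι → ℝ) := {w | (∀ i, 0 ≤ w i) ∧ ∑ i, w i = N ∧ x - ∑ i, w i • v i ∈ R}
  let f : ι → (ι → ℝ) →ᵃ[ℝ] ℝ := fun i =>
    (LinearMap.proj i : (ι → ℝ) →ₗ[ℝ] ℝ).toAffineMap - AffineMap.const ℝ (ι → ℝ) 1
  have hf : ∀ i w, f i w = w i - 1 := fun i w => by simp [f]
  have hC : Convex ℝ C := by
    rintro w ⟨hw0, hw1, hw2⟩ u ⟨hu0, hu1, hu2⟩ a b ha hb hab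
    refine ⟨fun i => add_nonneg (mul_nonneg ha (hw0 i)) (mul_nonneg hb (hu0 i)), ?_, ?_⟩
    · simp [Finset.sum_add_distrib, ← Finset.mul_sum, hw1, hu1, ← add_mul, hab]
    · convert hR hw2 hu2 ha hb hab using 1
      simp only [Pi.add_apply, Pi.smul_apply, smul_eq_mul, add_smul, mul_smul,
        Finset.sum_add_distrib, ← Finset.smul_sum, smul_sub]
      nth_rw 1 [← one_smul ℝ x, ← hab]
      module
  have hcov : ∀ w ∈ C, ∃ i ∈ (Finset.univ : Finset ι), 0 ≤ f i w := by
    rintro w ⟨-, hw1, -⟩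
    by_contra! h
    have : ∑ i, w i < ∑ _i : ι, (1 : ℝ) :=
      Finset.sum_lt_sum_of_nonempty Finset.univ_nonempty fun i hi => by
        have := h i hi
        rw [hf] at this
        linarith
    simp [hw1, hN] at this
  have key := sum_powerset_convexEuler_eq_zero f Finset.univ C hC hcov
  rw [Finset.powerset_univ] at key
  rw [← key]
  refine Finset.sum_congr rfl fun I _ => ?_
  have hcard : I.card ≤ N := Finset.card_le_univ I
  have hind : ∑ i, (if i ∈ I then (1 : ℝ) else 0) = I.card := by simp
  have hindv : ∑ i, (if i ∈ I then (1 : ℝ) else 0) • v i = ∑ i ∈ I, v i := by simp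
  unfold convexEuler
  congr 2
  rw [eq_iff_iff, Set.mem_add]
  simp only [mem_smul_convexHull_range v (Nat.cast_nonneg _)]
  constructor
  · rintro ⟨r, hr, y, ⟨w, hw0, hw1, rfl⟩, hy⟩
    refine ⟨fun i => w i + if i ∈ I then 1 else 0, ⟨fun i => ?_, ?_, ?_⟩, ?_⟩
    · have := hw0 i
      positivity
    · rw [Finset.sum_add_distrib, hw1, hind, Nat.cast_sub hcard]
      ring
    · simp only [add_smul, Finset.sum_add_distrib, hindv]
      rwa [sub_add_eq_sub_sub_swap, ← hy, add_sub_cancel_right]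
    · intro i hi
      simp [hf, hi, hw0 i]
  · rintro ⟨w, ⟨hw0, hw1, hw2⟩, hwI⟩
    refine ⟨_, hw2, _, ⟨fun i => w i - if i ∈ I then 1 else 0, fun i => ?_, ?_, rfl⟩, ?_⟩
    · dsimp only
      split_ifs with h
      · exact (hf i w) ▸ hwI i h
      · simpa using hw0 i
    · rw [Finset.sum_sub_distrib, hw1, hind, Nat.cast_sub hcard]
    · simp only [sub_smul, Finset.sum_sub_distrib, hindv]
      abel

theorem finite_latticePoints {d : ℕ} {P : Set (Fin d → ℝ)} (hP : Bornology.IsBounded P) :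
    {z : Fin d → ℤ | (fun i => (z i : ℝ)) ∈ P}.Finite := by
  obtain ⟨r, hr⟩ := hP.subset_closedBall 0
  refine (Set.finite_Icc (fun _ => -⌈r⌉) (fun _ => ⌈r⌉)).subset fun z hz => ?_
  have h := mem_closedBall_zero_iff.1 (hr hz)
  have hi : ∀ i, |(z i : ℝ)| ≤ ⌈r⌉ := fun i =>
    ((norm_le_pi_norm (fun i => (z i : ℝ)) i).trans h).trans (Int.le_ceil r)
  constructor <;> intro i
  · exact_mod_cast (abs_le.1 (hi i)).1
  · exact_mod_cast (abs_le.1 (hi i)).2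

theorem latticePointCount_eq_ncard_translate {d : ℕ} (P : Set (Fin d → ℝ)) (a : Fin d → ℤ) :
    latticePointCount P =
      {z : Fin d → ℤ | (fun i => (z i : ℝ)) - (fun i => (a i : ℝ)) ∈ P}.ncard := by
  unfold latticePointCount
  rw [← Set.ncard_image_of_injective _ (add_left_injective a)]
  congr 1
  ext z
  simp only [Set.mem_image, Set.mem_ofPred_eq]
  constructor
  · rintro ⟨w, hw, rfl⟩
    convert hw using 1
    ext i
    simp
  · intro hz
    refine ⟨z - a, ?_, sub_add_cancel z a⟩
    convert hz using 1
    ext i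
    simp

theorem fwdDiff_iter_latticePointCount_eq_zero {d : ℕ} {R : Set (Fin d → ℝ)} (hR : Convex ℝ R)
    (hRb : Bornology.IsBounded R) (V : Finset (Fin d → ℤ)) (hV : V.Nonempty) (n : ℕ) :
    (fwdDiff 1)^[V.card] (fun t : ℕ => (latticePointCount (R + (t : ℝ) • convexHull ℝ
      ((fun z : Fin d → ℤ => fun i => (z i : ℝ)) '' ↑V)) : ℤ)) n = 0 := by
  have : Nonempty V := hV.coe_sort
  let v : V → Fin d → ℝ := fun z i => (z.1 i : ℝ)
  have hrange : (fun z : Fin d → ℤ => fun i => (z i : ℝ)) '' ↑V = Set.range v := by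
    rw [Set.image_eq_range]
    rfl
  rw [hrange]
  set Q := convexHull ℝ (Set.range v) with hQ
  have hQc : Convex ℝ Q := convex_convexHull ℝ _
  have hQb : Bornology.IsBounded Q := ((Set.finite_range v).isCompact_convexHull ℝ).isBounded
  set S := R + (n : ℝ) • Q with hS
  have hSc : Convex ℝ S := hR.add (hQc.smul _)
  have hSb : Bornology.IsBounded S := hRb.add (hQb.smul₀ _)
  have hG : ∀ k : ℕ, R + ((n + k : ℕ) : ℝ) • Q = S + (k : ℝ) • Q := fun k => by
    rw [Nat.cast_add, hQc.add_smul (Nat.cast_nonneg _) (Nat.cast_nonneg _), add_assoc]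
  set N := V.card with hN
  have hcardV : Fintype.card V = N := Fintype.card_coe V
  -- the lattice points of a translate of the summand indexed by `I`
  let A : Finset V → Set (Fin d → ℤ) := fun I =>
    {z | (fun i => (z i : ℝ)) - ∑ j ∈ I, v j ∈ S + ((N - I.card : ℕ) : ℝ) • Q}
  have hcast : ∀ I : Finset V, ∑ j ∈ I, v j = fun i => ((∑ j ∈ I, j.1) i : ℝ) := fun I => by
    ext i
    simp [v]
  have hAfin : ∀ I, (A I).Finite := fun I => by
    have hb : Bornology.IsBounded
        ((S + ((N - I.card : ℕ) : ℝ) • Q) + {∑ j ∈ I, v j}) :=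
      (hSb.add (hQb.smul₀ _)).add Bornology.isBounded_singleton
    refine (finite_latticePoints hb).subset fun z hz => ?_
    exact ⟨_, hz, _, rfl, sub_add_cancel _ _⟩
  have hAcard : ∀ I, latticePointCount (S + ((N - I.card : ℕ) : ℝ) • Q) = (A I).ncard :=
    fun I => by
      rw [latticePointCount_eq_ncard_translate _ (∑ j ∈ I, j.1), ← hcast I]
  let T : Finset (Fin d → ℤ) := Finset.univ.biUnion fun I => (hAfin I).toFinset
  have hAsum : ∀ I, ((A I).ncard : ℤ) = ∑ z ∈ T, if z ∈ A I then 1 else 0 := fun I => by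
    rw [Finset.sum_boole, Set.ncard_eq_toFinset_card _ (hAfin I)]
    congr 2
    ext z
    simp only [Set.Finite.mem_toFinset, Finset.mem_filter, T, Finset.mem_biUnion,
      Finset.mem_univ, true_and]
    exact ⟨fun h => ⟨⟨I, h⟩, h⟩, fun h => h.2⟩
  have hzero : ∑ I : Finset V, (-1 : ℤ) ^ I.card *
      (latticePointCount (S + ((N - I.card : ℕ) : ℝ) • Q) : ℤ) = 0 := by
    simp_rw [hAcard, hAsum, Finset.mul_sum]
    rw [Finset.sum_comm]
    refine Finset.sum_eq_zero fun z _ => ?_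
    have := sum_indicator_minkowski_eq_zero v hSc (fun i => (z i : ℝ))
    rwa [hcardV] at this
  rw [← Finset.powerset_univ, Finset.sum_powerset_apply_card
    (fun k => (-1 : ℤ) ^ k * (latticePointCount (S + ((N - k : ℕ) : ℝ) • Q) : ℤ)),
    Finset.card_univ, hcardV] at hzero
  rw [fwdDiff_iter_eq_sum_shift, ← hzero, ← Finset.sum_range_reflect]
  refine Finset.sum_congr rfl fun k hk => ?_
  have hk : k ≤ N := Nat.lt_succ_iff.1 (Finset.mem_range.1 hk)
  have e1 : N + 1 - 1 - k = N - k := by omega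
  have e2 : N - (N - k) = k := by omega
  simp only [e1, e2, smul_eq_mul, mul_one, hG, Nat.choose_symm hk, nsmul_eq_mul]
  ring

/-- A sequence whose iterated forward differences vanish is polynomial. -/
theorem exists_polynomial_of_fwdDiff_iter_eq_zero (g : ℕ → ℝ) (N : ℕ)
    (h : ∀ n, (fwdDiff 1)^[N] g n = 0) :
    ∃ q : Polynomial ℝ, q.degree < N ∧ ∀ t : ℕ, g t = q.eval (t : ℝ) := by
  have hge : ∀ k, N ≤ k → ∀ n, (fwdDiff 1)^[k] g n = 0 := by
    intro k hk
    induction k, hk using Nat.le_induction with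
    | base => exact h
    | succ k _ ih =>
      intro n
      rw [Function.iterate_succ_apply', fwdDiff, ih, ih, sub_zero]
  refine ⟨∑ k ∈ Finset.range N, Polynomial.C ((fwdDiff 1)^[k] g 0 / k.factorial) *
    descPochhammer ℝ k, ?_, fun t => ?_⟩
  · rw [Polynomial.degree_lt_iff_coeff_zero]
    intro m hm
    rw [Polynomial.finsetSum_coeff]
    refine Finset.sum_eq_zero fun k hk => ?_
    rw [Polynomial.coeff_C_mul, Polynomial.coeff_eq_zero_of_natDegree_lt, mul_zero]
    rw [descPochhammer_natDegree]
    exact (Finset.mem_range.1 hk).trans_le hm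
  · have h1 := shift_eq_sum_fwdDiff_iter 1 g t 0
    rw [zero_add, smul_eq_mul, mul_one] at h1
    rw [h1, Polynomial.eval_finsetSum]
    have hterm : ∀ k, t.choose k • (fwdDiff 1)^[k] g 0 =
        (Polynomial.C ((fwdDiff 1)^[k] g 0 / k.factorial) * descPochhammer ℝ k).eval (t : ℝ) := by
      intro k
      rw [Polynomial.eval_mul, Polynomial.eval_C, descPochhammer_eval_eq_descFactorial,
        Nat.descFactorial_eq_factorial_mul_choose, nsmul_eq_mul]
      have : (k.factorial : ℝ) ≠ 0 := by positivity
      push_cast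
      field_simp
    simp_rw [← hterm]
    rcases le_total (t + 1) N with hle | hle
    · refine Finset.sum_subset (Finset.range_mono hle) fun k _ hk => ?_
      rw [Nat.choose_eq_zero_of_lt (by simpa using hk), zero_smul]
    · refine (Finset.sum_subset (Finset.range_mono hle) fun k _ hk => ?_).symm
      rw [hge k (by simpa using hk), smul_zero]

/-- A function on `ℕ^σ` that is polynomial of bounded degree in each variable separately is
polynomial. -/
theorem exists_mvPolynomial_of_separately {σ : Type*} [DecidableEq σ] (N : σ → ℕ) (s : Finset σ) :
    ∀ g : (σ → ℕ) → ℝ,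
      (∀ i ∈ s, ∀ n, ∃ q : Polynomial ℝ, q.degree < N i ∧
        ∀ t : ℕ, g (Function.update n i t) = q.eval (t : ℝ)) →
      (∀ n m, (∀ i ∈ s, n i = m i) → g n = g m) →
      ∃ p : MvPolynomial σ ℝ, ∀ n : σ → ℕ, g n = MvPolynomial.eval (fun i => (n i : ℝ)) p := by
  induction s using Finset.induction_on with
  | empty =>
    intro g _ hdep
    exact ⟨MvPolynomial.C (g 0), fun n => by simpa using hdep n 0⟩
  | insert a s ha ih =>
    intro g hg hdep
    have hex : ∀ j : ℕ, ∃ p : MvPolynomial σ ℝ, ∀ n : σ → ℕ,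
        g (Function.update n a j) = MvPolynomial.eval (fun i => (n i : ℝ)) p := by
      intro j
      refine ih (fun n => g (Function.update n a j)) (fun i hi n => ?_) fun n m hnm => ?_
      · have hia : i ≠ a := fun h => ha (h ▸ hi)
        obtain ⟨q, hq, hqe⟩ := hg i (Finset.mem_insert_of_mem hi) (Function.update n a j)
        refine ⟨q, hq, fun t => ?_⟩
        rw [← hqe, Function.update_comm hia]
      · refine hdep _ _ fun i hi => ?_
        rcases eq_or_ne i a with rfl | hia
        · simp
        · simp [hia, hnm i ((Finset.mem_insert.1 hi).resolve_left hia)]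
    choose p hp using hex
    have hinj : Set.InjOn (fun j : ℕ => (j : ℝ)) (Finset.range (N a)) :=
      Nat.cast_injective.injOn
    refine ⟨∑ j ∈ Finset.range (N a), p j *
      Polynomial.aeval (MvPolynomial.X a)
        (Lagrange.basis (Finset.range (N a)) (fun j : ℕ => (j : ℝ)) j), fun n => ?_⟩
    obtain ⟨q, hq, hqe⟩ := hg a (Finset.mem_insert_self a s) n
    have hq' := Lagrange.eq_interpolate_of_eval_eq
      (r := fun j : ℕ => g (Function.update n a j)) hinj (by simpa using hq)
      fun j _ => (hqe j).symm
    have hn : g n = q.eval (n a : ℝ) := by rw [← hqe, Function.update_eq_self]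
    rw [hn, hq', Lagrange.interpolate_apply, Polynomial.eval_finsetSum, map_sum]
    refine Finset.sum_congr rfl fun j _ => ?_
    rw [Polynomial.eval_mul, Polynomial.eval_C, map_mul, hp]
    congr 1
    rw [← MvPolynomial.coe_aeval_eq_eval, RingHom.coe_coe, ← Polynomial.aeval_algHom_apply,
      MvPolynomial.aeval_X, Polynomial.coe_aeval_eq_eval]

theorem exists_mvPolynomial_latticePointCount {d : ℕ} (P : Fin d → Set (Fin d → ℝ))
    (hP : ∀ i, IsLatticePolytope (P i)) :
    ∃ p : MvPolynomial (Fin d) ℝ, ∀ n : Fin d → ℕ,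
      (latticePointCount (∑ i, (n i : ℝ) • P i) : ℝ) =
        MvPolynomial.eval (fun i => (n i : ℝ)) p := by
  choose V hVne hV using hP
  have hconv : ∀ i, Convex ℝ (P i) := fun i => by
    rw [hV i]
    exact convex_convexHull ℝ _
  have hbdd : ∀ i, Bornology.IsBounded (P i) := fun i => by
    rw [hV i]
    exact (((V i).finite_toSet.image _).isCompact_convexHull ℝ).isBounded
  refine exists_mvPolynomial_of_separately (fun i => (V i).card) Finset.univ
    (fun n => (latticePointCount (∑ i, (n i : ℝ) • P i) : ℝ)) (fun i _ n => ?_)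
    fun n m h => by rw [funext fun i => h i (Finset.mem_univ i)]
  set R := ∑ j ∈ Finset.univ.erase i, (n j : ℝ) • P j with hR
  have hRc : Convex ℝ R := convex_sum _ fun j _ => (hconv j).smul _
  have hRb : Bornology.IsBounded R :=
    Finset.sum_induction _ Bornology.IsBounded (fun _ _ ha hb => ha.add hb)
      Bornology.isBounded_singleton fun j _ => (hbdd j).smul₀ _
  have hsplit : ∀ t : ℕ, ∑ j, ((Function.update n i t) j : ℝ) • P j = R + (t : ℝ) • P i := by
    intro t
    rw [← Finset.sum_erase_add _ _ (Finset.mem_univ i), Function.update_self, hR]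
    congr 1
    refine Finset.sum_congr rfl fun j hj => ?_
    rw [Function.update_of_ne (Finset.ne_of_mem_erase hj)]
  simp_rw [hsplit]
  refine exists_polynomial_of_fwdDiff_iter_eq_zero
    (fun t : ℕ => (latticePointCount (R + (t : ℝ) • P i) : ℝ)) _ fun k => ?_
  have hk := fwdDiff_iter_latticePointCount_eq_zero hRc hRb (V i) (hVne i) k
  rw [← hV i, fwdDiff_iter_eq_sum_shift] at hk
  rw [fwdDiff_iter_eq_sum_shift]
  simp only [smul_eq_mul, zsmul_eq_mul] at hk ⊢
  exact_mod_cast hk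

theorem sum_alternating_aeval_monomial {d : ℕ} {A : Type*} [CommRing A] [Algebra ℝ A] (x : A)
    (m : Fin d →₀ ℕ) (a : ℝ) :
    ∑ J : Finset (Fin d), (-1 : A) ^ (d - J.card) *
        MvPolynomial.aeval (fun i => if i ∈ J then x else 0) (MvPolynomial.monomial m a) =
      algebraMap ℝ A a * ∏ i, (x ^ m i - 0 ^ m i) := by
  simp_rw [sub_eq_add_neg]
  rw [Finset.prod_add, Finset.powerset_univ, Finset.mul_sum]
  refine Finset.sum_congr rfl fun J _ => ?_
  have hcard : d - J.card = (Finset.univ \ J).card := by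
    rw [Finset.card_sdiff_of_subset (Finset.subset_univ J), Finset.card_univ, Fintype.card_fin]
  have hprod : ∏ i, (if i ∈ J then x else 0) ^ m i =
      (∏ i ∈ J, x ^ m i) * ∏ i ∈ Finset.univ \ J, (0 : A) ^ m i := by
    rw [← Finset.prod_sdiff (Finset.subset_univ J), mul_comm]
    congr 1
    · exact Finset.prod_congr rfl fun i hi => by rw [if_pos hi]
    · exact Finset.prod_congr rfl fun i hi => by rw [if_neg (Finset.mem_sdiff.1 hi).2]
  rw [MvPolynomial.aeval_monomial, Finsupp.prod_fintype _ _ fun i => pow_zero _, hprod,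
    Finset.prod_neg, hcard]
  ring

theorem X_pow_dvd_sum_alternating_aeval {d : ℕ} (p : MvPolynomial (Fin d) ℝ) :
    (Polynomial.X : Polynomial ℝ) ^ d ∣
      ∑ J : Finset (Fin d), (-1 : Polynomial ℝ) ^ (d - J.card) *
        MvPolynomial.aeval (fun i => if i ∈ J then Polynomial.X else 0) p := by
  induction p using MvPolynomial.induction_on' with
  | monomial m a =>
    rw [sum_alternating_aeval_monomial]
    refine Dvd.dvd.mul_left ?_ _
    have : (Polynomial.X : Polynomial ℝ) ^ d = ∏ _i : Fin d, Polynomial.X := by simp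
    rw [this]
    refine Finset.prod_dvd_prod_of_dvd _ _ fun i _ => ?_
    rcases Nat.eq_zero_or_pos (m i) with h | h
    · simp [h]
    · rw [zero_pow h.ne', sub_zero]
      exact dvd_pow_self _ h.ne'
  | add p q hp hq =>
    simp only [map_add, mul_add, Finset.sum_add_distrib]
    exact dvd_add hp hq

theorem sum_alternating_eval_of_isHomogeneous {d : ℕ} {V : MvPolynomial (Fin d) ℝ}
    (hV : V.IsHomogeneous d) :
    ∑ J : Finset (Fin d), (-1 : ℝ) ^ (d - J.card) *
        MvPolynomial.eval (fun i => if i ∈ J then 1 else 0) V =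
      V.coeff (Finsupp.equivFunOnFinite.symm fun _ => 1) := by
  have hterm : ∀ m ∈ V.support,
      ∑ J : Finset (Fin d), (-1 : ℝ) ^ (d - J.card) *
        MvPolynomial.eval (fun i => if i ∈ J then 1 else 0)
          (MvPolynomial.monomial m (V.coeff m)) =
      if m = Finsupp.equivFunOnFinite.symm (fun _ => 1) then V.coeff m else 0 := by
    intro m hm
    simp_rw [← MvPolynomial.coe_aeval_eq_eval, RingHom.coe_coe]
    rw [sum_alternating_aeval_monomial]
    simp only [Algebra.algebraMap_self, RingHom.id_apply, one_pow]
    split_ifs with h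
    · simp [h]
    · obtain ⟨i, hi⟩ : ∃ i, m i = 0 := by
        by_contra! hne
        have hdeg : ∑ i, m i = ∑ _i : Fin d, 1 := by
          have := hV (MvPolynomial.mem_support_iff.1 hm)
          simpa [Finsupp.weight_apply, Finsupp.sum_fintype] using this
        have hall := (Finset.sum_eq_sum_iff_of_le fun i _ => Nat.one_le_iff_ne_zero.2 (hne i)).1
          hdeg.symm
        exact h (Finsupp.ext fun i => (hall i (Finset.mem_univ i)).symm)
      rw [Finset.prod_eq_zero (Finset.mem_univ i) (by simp [hi]), mul_zero]
  conv_lhs => rw [V.as_sum]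
  simp_rw [map_sum, Finset.mul_sum]
  rw [Finset.sum_comm, Finset.sum_congr rfl hterm, Finset.sum_ite_eq']
  split_ifs with h
  · rfl
  · exact (MvPolynomial.notMem_support_iff.1 h).symm

theorem tendsto_latticePointCount_smul_div_pow {d : ℕ} {S : Set (Fin d → ℝ)} (hS : IsCompact S)
    (hSc : Convex ℝ S) :
    Tendsto (fun n : ℕ => (latticePointCount ((n : ℝ) • S) : ℝ) / (n : ℝ) ^ d) atTop
      (nhds (volume S).toReal) := by
  have h := tendsto_card_div_pow_atTop_volume S hS.isBounded hS.measurableSet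
    (hSc.addHaar_frontier volume)
  rw [Fintype.card_fin] at h
  refine h.congr' ?_
  filter_upwards [eventually_ne_atTop 0] with n hn
  have hn' : (n : ℝ) ≠ 0 := Nat.cast_ne_zero.2 hn
  congr 2
  rw [Nat.card_coe_set_eq, latticePointCount]
  have hinj : Function.Injective
      (fun z : Fin d → ℤ => (n : ℝ)⁻¹ • fun i => (z i : ℝ)) := fun z w hzw => by
    ext i
    have := congrFun (smul_right_injective _ (inv_ne_zero hn') hzw) i
    exact_mod_cast this
  rw [← Set.ncard_image_of_injective _ hinj]
  congr 1
  ext x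
  simp only [Set.mem_inter_iff, Set.mem_image, Set.mem_ofPred_eq]
  rw [Set.mem_inv_smul_set_iff₀ hn', SetLike.mem_coe, Module.Basis.mem_span_iff_repr_mem]
  constructor
  · rintro ⟨hx, hz⟩
    choose z hz using hz
    have hzx : (fun i => (z i : ℝ)) = (n : ℝ) • x := by
      ext i
      simpa using hz i
    refine ⟨z, ?_, ?_⟩
    · rw [hzx]
      exact Set.smul_mem_smul_set hx
    · rw [hzx, inv_smul_smul₀ hn']
  · rintro ⟨z, hz, rfl⟩
    refine ⟨(Set.mem_smul_set_iff_inv_smul_mem₀ hn' _ _).1 hz, fun i => ⟨z i, ?_⟩⟩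
    rw [smul_inv_smul₀ hn']
    simp

/-- **Bernstein.** For `d` lattice polytopes `P_1, …, P_d ⊆ ℝ^d` whose Minkowski sum is
`d`-dimensional, the mixed Ehrhart polynomial is `ME(n) = c ⬝ n^d`, where `c` is the
coefficient of `n_1 n_2 ⋯ n_d` in the volume polynomial `V` of `(P_1, …, P_d)`,
i.e. `c = d! ⬝ MV_d(P_1, …, P_d)`. -/
theorem mixed_ehrhart_of_d_polytopes_eq_mixed_volume_monomial
    {d : ℕ} (P : Fin d → Set (Fin d → ℝ))
    (hP : ∀ i, IsLatticePolytope (P i))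
    (hdim : polytopeDim (∑ i, P i) = d)
    (M : Polynomial ℝ) (hMdeg : M.natDegree ≤ d)
    (hM : ∀ n : ℕ, M.eval (n : ℝ) = (DMV (fun i => (n : ℝ) • P i) : ℝ))
    (V : MvPolynomial (Fin d) ℝ) (hVhom : V.IsHomogeneous d)
    (hV : ∀ n : Fin d → ℝ, (∀ i, 0 ≤ n i) →
      MvPolynomial.eval n V = (MeasureTheory.volume (∑ i, n i • P i)).toReal) :
    M = Polynomial.C (V.coeff (Finsupp.equivFunOnFinite.symm fun _ => 1)) *
          Polynomial.X ^ d := by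
  have hne : ∀ i, (P i).Nonempty := fun i => by
    obtain ⟨W, hW, h⟩ := hP i
    rw [h, convexHull_nonempty_iff, Set.image_nonempty]
    exact hW
  have hconv : ∀ i, Convex ℝ (P i) := fun i => by
    obtain ⟨W, -, h⟩ := hP i
    rw [h]
    exact convex_convexHull ℝ _
  have hcomp : ∀ i, IsCompact (P i) := fun i => by
    obtain ⟨W, -, h⟩ := hP i
    rw [h]
    exact (W.finite_toSet.image _).isCompact_convexHull ℝ
  have hsum : ∀ (J : Finset (Fin d)) (r : ℝ),
      ∑ j ∈ J, r • P j = ∑ i, (if i ∈ J then r else 0) • P i := fun J r => by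
    have : ∀ i, (if i ∈ J then r else 0) • P i = if i ∈ J then r • P i else 0 := fun i => by
      split_ifs
      · rfl
      · exact Set.zero_smul_set (hne i)
    simp_rw [this, Finset.sum_ite_mem, Finset.univ_inter]
  obtain ⟨p, hp⟩ := exists_mvPolynomial_latticePointCount P hP
  have hMp : M = ∑ J : Finset (Fin d), (-1 : Polynomial ℝ) ^ (d - J.card) *
      MvPolynomial.aeval (fun i => if i ∈ J then Polynomial.X else 0) p := by
    refine Polynomial.eq_of_infinite_eval_eq _ _
      ((Set.infinite_range_of_injective (Nat.cast_injective (R := ℝ))).mono ?_)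
    rintro _ ⟨n, rfl⟩
    rw [Set.mem_ofPred_eq, hM, DMV, Polynomial.eval_finsetSum]
    push_cast
    refine Finset.sum_congr rfl fun J _ => ?_
    have h := hp fun i => if i ∈ J then n else 0
    have hcast : ∀ i, ((if i ∈ J then n else 0 : ℕ) : ℝ) = if i ∈ J then (n : ℝ) else 0 :=
      fun i => by split_ifs <;> simp
    simp_rw [hcast] at h
    rw [hsum, h, Polynomial.eval_mul]
    congr 1
    · simp
    · rw [← Polynomial.coe_evalRingHom, ← Polynomial.coe_aeval_eq_evalRingHom, RingHom.coe_coe,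
        MvPolynomial.comp_aeval_apply, ← MvPolynomial.coe_aeval_eq_eval, RingHom.coe_coe]
      congr 2
      ext i
      split_ifs <;> simp
  obtain ⟨c, hc⟩ : ∃ c : ℝ, M = Polynomial.C c * Polynomial.X ^ d := by
    obtain ⟨q, hq⟩ : (Polynomial.X : Polynomial ℝ) ^ d ∣ M := by
      rw [hMp]
      exact X_pow_dvd_sum_alternating_aeval p
    refine ⟨q.coeff 0, ?_⟩
    have hq0 : q.natDegree = 0 := by
      rcases eq_or_ne q 0 with rfl | hq0
      · simp
      · rw [hq, Polynomial.natDegree_X_pow_mul d hq0] at hMdeg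
        omega
    rw [← Polynomial.eq_C_of_natDegree_eq_zero hq0, hq, mul_comm]
  suffices c = V.coeff (Finsupp.equivFunOnFinite.symm fun _ => 1) by rw [hc, this]
  rw [← sum_alternating_eval_of_isHomogeneous hVhom]
  have hlim : Tendsto (fun n : ℕ => ∑ J : Finset (Fin d), (-1 : ℝ) ^ (d - J.card) *
      ((latticePointCount ((n : ℝ) • ∑ j ∈ J, P j) : ℝ) / (n : ℝ) ^ d)) atTop
      (nhds (∑ J : Finset (Fin d), (-1 : ℝ) ^ (d - J.card) *
        MvPolynomial.eval (fun i => if i ∈ J then 1 else 0) V)) := by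
    refine tendsto_finsetSum _ fun J _ => Tendsto.const_mul _ ?_
    rw [hV _ fun i => by split_ifs <;> norm_num, ← hsum J 1]
    simp_rw [one_smul]
    exact tendsto_latticePointCount_smul_div_pow
      (Finset.sum_induction _ IsCompact (fun _ _ ha hb => ha.add hb) isCompact_singleton
        fun j _ => hcomp j)
      (convex_sum _ fun j _ => hconv j)
  refine tendsto_nhds_unique (tendsto_const_nhds.congr' ?_) hlim
  filter_upwards [eventually_ne_atTop 0] with n hn
  have hn' : (n : ℝ) ^ d ≠ 0 := pow_ne_zero _ (Nat.cast_ne_zero.2 hn)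
  have h := hM n
  rw [hc, Polynomial.eval_mul, Polynomial.eval_C, Polynomial.eval_pow, Polynomial.eval_X, DMV] at h
  push_cast at h
  simp_rw [mul_div_assoc', ← Finset.sum_div, Finset.smul_sum]
  rw [eq_div_iff hn', h]
end

section
/- Let P ⊆ ℝ^d be a d-dimensional lattice polytope, let k ≥ 1, and let 𝐏 = (P,…,P) be the collection of k copies of P. Then for all integers n ≥ 0, ME_𝐏(n) = Σ_{j=0}^d ( Σ_{i=0}^k (−1)^{k−i} binom(k,i) binom(in + d − j, d) ) h_j*(P), where (h_0*(P),…,h_d*(P)) is the h*-vector of P. -/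
open Pointwise MeasureTheory Filter
open scoped Classical

/-- The Minkowski sum of finitely many copies of a nonempty convex set is a dilate of it. -/
theorem Convex.sum_const_eq_smul {E ι : Type*} [AddCommGroup E] [Module ℝ E] {S : Set E}
    (hS : Convex ℝ S) (hne : S.Nonempty) (J : Finset ι) :
    ∑ _j ∈ J, S = (J.card : ℝ) • S := by
  induction J using Finset.induction_on with
  | empty => simp [Set.zero_smul_set hne]
  | insert a J ha ih =>
    rw [Finset.sum_insert ha, ih, Finset.card_insert_of_notMem ha, Nat.cast_add, Nat.cast_one,
      add_comm (J.card : ℝ), hS.add_smul zero_le_one (Nat.cast_nonneg _), one_smul]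

/-- A lattice polytope is convex. -/
theorem IsLatticePolytope.convex {d : ℕ} {P : Set (Fin d → ℝ)} (hP : IsLatticePolytope P) :
    Convex ℝ P := by
  obtain ⟨V, -, rfl⟩ := hP
  exact convex_convexHull ℝ _

/-- A lattice polytope is nonempty. -/
theorem IsLatticePolytope.nonempty {d : ℕ} {P : Set (Fin d → ℝ)} (hP : IsLatticePolytope P) :
    P.Nonempty := by
  obtain ⟨V, hV, rfl⟩ := hP
  exact (hV.to_set.image _).convexHull

/-- The discrete mixed volume of `k` copies of a dilated lattice polytope is an alternating sum
of values of its lattice point enumerator. -/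
theorem IsLatticePolytope.dmv_const_smul {d : ℕ} {P : Set (Fin d → ℝ)}
    (hP : IsLatticePolytope P) (k n : ℕ) :
    DMV (fun _ : Fin k => (n : ℝ) • P) = ∑ i ∈ Finset.range (k + 1),
      (-1) ^ (k - i) * (k.choose i : ℤ) * (latticePointCount (((i * n : ℕ) : ℝ) • P) : ℤ) := by
  have hsum (J : Finset (Fin k)) :
      ∑ _j ∈ J, (n : ℝ) • P = ((J.card * n : ℕ) : ℝ) • P := by
    rw [(hP.convex.smul _).sum_const_eq_smul hP.nonempty.smul_set, smul_smul, Nat.cast_mul]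
  simp only [DMV, hsum]
  rw [← Finset.powerset_univ, Finset.sum_powerset_apply_card
    (fun i => (-1) ^ (k - i) * (latticePointCount (((i * n : ℕ) : ℝ) • P) : ℤ))]
  simp only [Finset.card_univ, Fintype.card_fin, nsmul_eq_mul]
  exact Finset.sum_congr rfl fun i _ => by ring

/-- **The mixed Ehrhart polynomial of `k` copies of a polytope via its `h^*`-vector.**
If `P ⊆ ℝ^d` is a `d`-dimensional lattice polytope with `h^*`-vector `h` (so that
`E_P(n) = ∑_j h_j binom(n + d - j, d)`), then for all `n ≥ 0`,
`ME_{(P,…,P)}(n) = ∑_{j=0}^d (∑_{i=0}^k (-1)^{k-i} binom(k,i) binom(i n + d - j, d)) h_j`. -/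
theorem mixed_ehrhart_of_copies_via_hstar
    {d k : ℕ} (hk : 1 ≤ k) (P : Set (Fin d → ℝ))
    (hP : IsLatticePolytope P) (hPdim : polytopeDim P = d)
    (h : ℕ → ℝ)
    (hh : ∀ n : ℕ, (latticePointCount ((n : ℝ) • P) : ℝ)
      = ∑ j ∈ Finset.range (d + 1), h j * ((n + d - j).choose d : ℕ)) :
    ∀ n : ℕ,
      (DMV (fun _ : Fin k => (n : ℝ) • P) : ℝ)
        = ∑ j ∈ Finset.range (d + 1),
            (∑ i ∈ Finset.range (k + 1),
              (-1 : ℝ) ^ (k - i) * (k.choose i : ℕ) * ((i * n + d - j).choose d : ℕ)) *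
            h j := by
  intro n
  rw [hP.dmv_const_smul]
  simp only [Int.cast_sum, Int.cast_mul, Int.cast_pow, Int.cast_neg, Int.cast_one,
    Int.cast_natCast, hh]
  simp only [Finset.mul_sum, Finset.sum_mul]
  rw [Finset.sum_comm]
  exact Finset.sum_congr rfl fun j _ => Finset.sum_congr rfl fun i _ => by ring
end

section
/- Let P_1, …, P_k be lattice polytopes in ℝ^d, each containing the origin 0, such that dim(P_1 + ⋯ + P_k) = dim P_1 + ⋯ + dim P_k. Then DMV(P_1,…,P_k) equals the number of lattice points z ∈ (P_1 + ⋯ + P_k) ∩ ℤ^d that are not contained in P_J for any proper subset J ⊊ [k]. -/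
open Pointwise MeasureTheory Filter
open scoped Classical

/-- The dimension of a set containing the origin is the dimension of its linear span. -/
lemma polytopeDim_eq_finrank_span {d : ℕ} {P : Set (Fin d → ℝ)} (h0 : (0 : Fin d → ℝ) ∈ P) :
    polytopeDim P = Module.finrank ℝ (Submodule.span ℝ P) := by
  have himage : (· -ᵥ (0 : Fin d → ℝ)) '' P = P := by simp
  rw [polytopeDim, direction_affineSpan, vectorSpan_eq_span_vsub_set_right ℝ h0, himage]

/-- A finite-dimensional family of sets whose sum spans a space of dimension at least the sum of
the dimensions of the individual spans has unique decompositions. -/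
lemma eq_of_sum_eq_of_sum_finrank_span_le {ι E : Type*} [Fintype ι] [AddCommGroup E] [Module ℝ E]
    [FiniteDimensional ℝ E] {P : ι → Set E}
    (hdim : ∑ i, Module.finrank ℝ (Submodule.span ℝ (P i)) ≤
      Module.finrank ℝ (Submodule.span ℝ (∑ i, P i)))
    {g h : ι → E} (hg : ∀ i, g i ∈ P i) (hh : ∀ i, h i ∈ P i) (hgh : ∑ i, g i = ∑ i, h i) :
    g = h := by
  let V : ι → Submodule ℝ E := fun i => Submodule.span ℝ (P i)
  let φ : (∀ i, V i) →ₗ[ℝ] E := ∑ i, (V i).subtype ∘ₗ LinearMap.proj i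
  have hφ : ∀ v, φ v = ∑ i, (v i : E) := fun v => by simp [φ]
  have hle : Submodule.span ℝ (∑ i, P i) ≤ LinearMap.range φ := by
    rw [Submodule.span_le]
    intro x hx
    obtain ⟨f, hf, rfl⟩ := Set.mem_fintype_sum _ _ |>.1 hx
    exact ⟨fun i => ⟨f i, Submodule.subset_span (hf i)⟩, by simp [hφ]⟩
  have h1 := Submodule.finrank_mono hle
  have h2 := LinearMap.finrank_range_add_finrank_ker φ
  rw [Module.finrank_pi_fintype] at h2
  have h3 : Module.finrank ℝ (LinearMap.ker φ) = 0 := by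
    have : ∑ i, Module.finrank ℝ (V i) = ∑ i, Module.finrank ℝ (Submodule.span ℝ (P i)) := rfl
    omega
  have hinj : Function.Injective φ :=
    LinearMap.ker_eq_bot.1 (Submodule.finrank_eq_zero.1 h3)
  have key := @hinj (fun i => ⟨g i, Submodule.subset_span (hg i)⟩)
    (fun i => ⟨h i, Submodule.subset_span (hh i)⟩) (by simpa [hφ] using hgh)
  funext i
  exact congrArg Subtype.val (congrFun key i)

/-- If every set contains zero, membership in a partial sum means having a decomposition that
vanishes outside the partial index set. -/
lemma mem_finset_sum_iff_exists_vanishing {ι E : Type*} [Fintype ι] [AddCommMonoid E]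
    {P : ι → Set E} (h0 : ∀ i, (0 : E) ∈ P i) (J : Finset ι) (x : E) :
    x ∈ ∑ j ∈ J, P j ↔
      ∃ g : ι → E, (∀ i, g i ∈ P i) ∧ (∀ i ∉ J, g i = 0) ∧ ∑ i, g i = x := by
  rw [Set.mem_finsetSum]
  constructor
  · rintro ⟨g, hg, rfl⟩
    refine ⟨fun i => if i ∈ J then g i else 0, fun i => ?_, fun i hi => by simp [hi], ?_⟩
    · by_cases hi : i ∈ J
      · simpa [hi] using hg hi
      · simpa [hi] using h0 i
    · simp
  · rintro ⟨g, hg, hz, rfl⟩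
    exact ⟨g, fun {i} _ => hg i, Finset.sum_subset (Finset.subset_univ J) fun i _ hi => hz i hi⟩

/-- A family of sets containing zero with unique decompositions admits a support function
detecting membership in the partial sums. -/
lemma exists_support_of_unique_sum {ι E : Type*} [Fintype ι] [AddCommMonoid E]
    {P : ι → Set E} (h0 : ∀ i, (0 : E) ∈ P i)
    (huniq : ∀ g h : ι → E, (∀ i, g i ∈ P i) → (∀ i, h i ∈ P i) →
      ∑ i, g i = ∑ i, h i → g = h) :
    ∃ supp : E → Finset ι, ∀ x ∈ ∑ i, P i, ∀ J : Finset ι, x ∈ ∑ j ∈ J, P j ↔ supp x ⊆ J := by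
  have hdec : ∀ x : E, ∃ g : ι → E, x ∈ ∑ i, P i → (∀ i, g i ∈ P i) ∧ ∑ i, g i = x := by
    intro x
    by_cases hx : x ∈ ∑ i, P i
    · obtain ⟨g, hg, h⟩ := (Set.mem_fintype_sum _ _).1 hx
      exact ⟨g, fun _ => ⟨hg, h⟩⟩
    · exact ⟨0, fun h => absurd h hx⟩
  choose c hc using hdec
  refine ⟨fun x => Finset.univ.filter fun i => c x i ≠ 0, fun x hx J => ?_⟩
  obtain ⟨hcP, hcx⟩ := hc x hx
  rw [mem_finset_sum_iff_exists_vanishing h0]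
  constructor
  · rintro ⟨g, hg, hz, hgx⟩ i hi
    have hcg := huniq (c x) g hcP hg (hcx.trans hgx.symm)
    by_contra hiJ
    simp [hcg, hz i hiJ] at hi
  · intro hJ
    refine ⟨c x, hcP, fun i hi => ?_, hcx⟩
    by_contra hne
    exact hi (hJ (by simp [hne]))

/-- A bounded set has finitely many lattice points. -/
lemma finite_lattice_points_of_isBounded {d : ℕ} {K : Set (Fin d → ℝ)}
    (hK : Bornology.IsBounded K) : {z : Fin d → ℤ | (fun i => (z i : ℝ)) ∈ K}.Finite := by
  obtain ⟨R, hR⟩ := hK.exists_norm_le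
  refine (Set.finite_Icc (fun _ : Fin d => -⌈R⌉) (fun _ => ⌈R⌉)).subset fun z hz => ?_
  have hz' : ∀ i, |(z i : ℝ)| ≤ ⌈R⌉ := fun i =>
    ((norm_le_pi_norm (fun i => (z i : ℝ)) i).trans (hR _ hz)).trans (Int.le_ceil R)
  constructor
  · intro i
    exact_mod_cast (abs_le.1 (hz' i)).1
  · intro i
    exact_mod_cast (abs_le.1 (hz' i)).2

lemma IsLatticePolytope.isBounded {d : ℕ} {P : Set (Fin d → ℝ)} (hP : IsLatticePolytope P) :
    Bornology.IsBounded P := by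
  obtain ⟨V, -, rfl⟩ := hP
  exact isBounded_convexHull.2 (V.finite_toSet.image _).isBounded

lemma isBounded_finset_sum {ι E : Type*} [SeminormedAddCommGroup E] {P : ι → Set E}
    (J : Finset ι) (hP : ∀ i ∈ J, Bornology.IsBounded (P i)) :
    Bornology.IsBounded (∑ j ∈ J, P j) :=
  Finset.sum_induction P Bornology.IsBounded (fun _ _ => Bornology.IsBounded.add)
    (by rw [← Set.singleton_zero]; exact Bornology.isBounded_singleton) hP

/-- The alternating sum over the supersets of `A` vanishes unless `A` is everything. -/
lemma sum_neg_one_pow_card_sub_of_subset {ι : Type*} [Fintype ι] (A : Finset ι) :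
    ∑ J : Finset ι, (if A ⊆ J then (-1 : ℤ) ^ (Fintype.card ι - J.card) else 0) =
      if A = Finset.univ then 1 else 0 := by
  rw [← Finset.sum_filter]
  have : ∑ J with A ⊆ J, (-1 : ℤ) ^ (Fintype.card ι - J.card) =
      ∑ B ∈ Aᶜ.powerset, (-1 : ℤ) ^ B.card := by
    refine Finset.sum_nbij' (fun J => Jᶜ) (fun B => Bᶜ) ?_ ?_ ?_ ?_ ?_
    · intro J hJ
      simpa using hJ
    · intro B hB
      simpa [Finset.subset_compl_comm] using hB
    · simp
    · simp
    · intro J _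
      rw [Finset.card_compl]
  rw [this, Finset.sum_powerset_neg_one_pow_card]
  simp [Finset.compl_eq_empty_iff]

/-- Inclusion-exclusion: the alternating count of elements by support counts those with full
support. -/
lemma sum_neg_one_pow_mul_card_filter_subset {ι α : Type*} [Fintype ι] (S : Finset α)
    (supp : α → Finset ι) :
    ∑ J : Finset ι, (-1 : ℤ) ^ (Fintype.card ι - J.card) *
        ((S.filter fun z => supp z ⊆ J).card : ℤ) =
      ((S.filter fun z => supp z = Finset.univ).card : ℤ) := by
  simp only [Finset.card_filter, Nat.cast_sum, Finset.mul_sum]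
  rw [Finset.sum_comm]
  refine Finset.sum_congr rfl fun z _ => ?_
  simpa using sum_neg_one_pow_card_sub_of_subset (supp z)

/-- **A combinatorial interpretation of the discrete mixed volume.**
If the lattice polytopes `P_1, …, P_k ⊆ ℝ^d` all contain the origin and
`dim (P_1 + ⋯ + P_k) = dim P_1 + ⋯ + dim P_k`, then `DMV(P_1, …, P_k)` counts the
lattice points of `P_1 + ⋯ + P_k` lying in no proper subsum `P_J`, `J ⊊ [k]`. -/
theorem dmv_eq_card_lattice_points_not_in_proper_subsums
    {d k : ℕ} (P : Fin k → Set (Fin d → ℝ))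
    (hP : ∀ i, IsLatticePolytope (P i))
    (h0 : ∀ i, (0 : Fin d → ℝ) ∈ P i)
    (hdim : polytopeDim (∑ i, P i) = ∑ i, polytopeDim (P i)) :
    DMV P
      = (Set.ncard {z : Fin d → ℤ |
          (fun i => (z i : ℝ)) ∈ ∑ i, P i ∧
          ∀ J : Finset (Fin k), J ≠ Finset.univ →
            (fun i => (z i : ℝ)) ∉ ∑ j ∈ J, P j} : ℤ) := by
  have h0sum : (0 : Fin d → ℝ) ∈ ∑ i, P i :=
    (Set.mem_fintype_sum _ _).2 ⟨0, h0, by simp⟩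
  have hfin := finite_lattice_points_of_isBounded
    (isBounded_finset_sum Finset.univ fun i _ => (hP i).isBounded)
  simp only [polytopeDim_eq_finrank_span h0sum, fun i => polytopeDim_eq_finrank_span (h0 i)]
    at hdim
  obtain ⟨supp, hsupp⟩ := exists_support_of_unique_sum h0 fun g h hg hh hgh =>
    eq_of_sum_eq_of_sum_finrank_span_le hdim.ge hg hh hgh
  have hmono : ∀ (J : Finset (Fin k)) (x : Fin d → ℝ), x ∈ ∑ j ∈ J, P j → x ∈ ∑ i, P i := by
    intro J x hx
    obtain ⟨g, hg, -, hgx⟩ := (mem_finset_sum_iff_exists_vanishing h0 J x).1 hx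
    exact (Set.mem_fintype_sum _ _).2 ⟨g, hg, hgx⟩
  let emb : (Fin d → ℤ) → Fin d → ℝ := fun z i => z i
  have hcount : ∀ J : Finset (Fin k), latticePointCount (∑ j ∈ J, P j) =
      (hfin.toFinset.filter fun z => supp (emb z) ⊆ J).card := by
    intro J
    unfold latticePointCount
    rw [← Set.ncard_coe_finset]
    congr 1
    ext z
    simp only [Set.mem_ofPred_eq, Finset.coe_filter, Set.Finite.mem_toFinset]
    exact ⟨fun h => ⟨hmono J _ h, (hsupp _ (hmono J _ h) J).1 h⟩,
      fun h => (hsupp _ h.1 J).2 h.2⟩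
  have hsum := sum_neg_one_pow_mul_card_filter_subset hfin.toFinset fun z => supp (emb z)
  rw [Fintype.card_fin] at hsum
  have hDMV : DMV P = ((hfin.toFinset.filter fun z => supp (emb z) = Finset.univ).card : ℤ) := by
    simp only [DMV, hcount]
    convert hsum
  rw [hDMV, ← Set.ncard_coe_finset]
  congr 2
  ext z
  simp only [Set.mem_ofPred_eq, Finset.coe_filter, Set.Finite.mem_toFinset]
  refine and_congr_right fun hz => ⟨fun h J hJ hzJ => hJ ?_, fun h => ?_⟩
  · exact Finset.univ_subset_iff.1 (h ▸ (hsupp _ hz J).1 hzJ)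
  · by_contra hne
    exact h _ hne ((hsupp _ hz _).2 subset_rfl)
end
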